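/- arXiv:2301.11137 — 2 statements merged into one kernel-verified Lean document; each statement's English description precedes it below -/
import Mathlib

section
/- Let q, x, y₁, y₂, z be complex numbers with |q| < 1 and |x|, |y₁|, |y₂|, |z| ≤ 1. Let 𝒜_{1̄} = {λ = (P,O) ∈ 𝒜 : 1 ∉ O} (the part 1̄ is forbidden). Then Σ_{λ ∈ 𝒜_{1̄}} x^{♯(λ)} y₁^{♯_{2,4}(λ)} y₂^{♯_{0,4}(λ)} z^{𝖮(λ)} q^{|λ|} = Σ_{n₁,n₂,n₃,n₄ ≥ 0} x^{n₁+n₂+n₃+n₄} y₁^{n₃} y₂^{n₄} z^{n₂} q^{Q(n₁,n₂,n₃,n₄) + n₁ + 3n₂ + 2n₃ + 4n₄} / ((q²;q²)_{n₁}(q²;q²)_{n₂}(q⁴;q⁴)_{n₃}(q⁴;q⁴)_{n₄}), where both series converge absolutely. -/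
/-- The finite q-Pochhammer symbol `(a; q)_n = ∏_{k=0}^{n-1} (1 - a q^k)`. -/
noncomputable def qPoch (a q : ℂ) (n : ℕ) : ℂ :=
  ∏ k ∈ Finset.range n, (1 - a * q ^ k)

/-- The quadratic form `Q(n₁,n₂,n₃,n₄)`. -/
def Qform (n₁ n₂ n₃ n₄ : ℕ) : ℕ :=
  4 * Nat.choose n₁ 2 + 6 * Nat.choose n₂ 2 + 4 * Nat.choose n₃ 2 + 8 * Nat.choose n₄ 2 +
    4 * (n₁ * n₂ + n₁ * n₃ + n₁ * n₄ + n₂ * n₃ + n₂ * n₄ + n₃ * n₄)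

/-- Membership in the set `𝒜`: an overpartition is a pair `(P, O)` with `P` a finite set of
positive integers (the parts) and `O ⊆ {p ∈ P : p odd}` (the overlined parts), such that any
two parts `a > b` differ by at least 4, and by at least 5 whenever `a` is overlined or
divisible by 4. -/
def MemA (P O : Finset ℕ) : Prop :=
  (∀ p ∈ P, 0 < p) ∧ O ⊆ P ∧ (∀ p ∈ O, Odd p) ∧
    ∀ a ∈ P, ∀ b ∈ P, b < a →
      4 ≤ a - b ∧ ((a ∈ O ∨ 4 ∣ a) → 5 ≤ a - b)

/-- `♯_{a,M}(λ)`: the number of parts of `λ` congruent to `a` modulo `M`. -/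
def countMod (a M : ℕ) (P : Finset ℕ) : ℕ := (P.filter fun p => p % M = a).card

section QDifferenceSystem

open Filter Topology

/-- A system `u_j = v_{j+1} + α_j u_{j+4}`, `v_j = v_{j+1} + β_j u_{j+4}` with geometrically small
coefficients has no nonzero solution vanishing at infinity. -/
theorem eq_zero_of_recurrence {r : ℝ} (hr₀ : 0 ≤ r) (hr : r < 1) {α β u v : ℕ → ℂ}
    (hα : ∀ j, ‖α j‖ ≤ 2 * r ^ j) (hβ : ∀ j, ‖β j‖ ≤ 2 * r ^ j)
    (hu : ∀ j, 1 ≤ j → u j = v (j + 1) + α j * u (j + 4))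
    (hv : ∀ j, 1 ≤ j → v j = v (j + 1) + β j * u (j + 4))
    (hu₀ : Tendsto u atTop (𝓝 0)) (hv₀ : Tendsto v atTop (𝓝 0)) {j : ℕ} (hj : 1 ≤ j) :
    u j = 0 := by
  have h1r : 0 < 1 - r := by linarith
  set E : ℕ → ℝ := fun j => Real.exp (2 * r ^ j / (1 - r)) with hE
  have hE_pos : ∀ j, 0 < E j := fun j => Real.exp_pos _
  have hE_one : ∀ j, 1 ≤ E j := fun j => Real.one_le_exp (by positivity)
  have hE_succ : ∀ j, E (j + 1) + 2 * r ^ j * E (j + 1) ≤ E j := fun j => by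
    have h : E j = Real.exp (2 * r ^ j) * E (j + 1) := by
      simp only [hE, ← Real.exp_add]
      congr 1
      field_simp
      ring
    rw [h]
    nlinarith [hE_pos (j + 1), Real.add_one_le_exp (2 * r ^ j)]
  have hE_anti : ∀ j, E (j + 4) ≤ E (j + 1) := fun j => by
    have : r ^ (j + 4) ≤ r ^ (j + 1) := pow_le_pow_of_le_one hr₀ hr.le (by omega)
    simp only [hE]
    gcongr
  have key : ∀ ε : ℝ, 0 < ε → ‖u j‖ ≤ ε * E j := by
    intro ε hε
    have hsmall : ∀ᶠ k in atTop, ‖u k‖ ≤ ε ∧ ‖v k‖ ≤ ε :=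
      ((tendsto_zero_iff_norm_tendsto_zero.1 hu₀).eventually_le_const hε).and
        ((tendsto_zero_iff_norm_tendsto_zero.1 hv₀).eventually_le_const hε)
    obtain ⟨N, hN⟩ := eventually_atTop.1 hsmall
    have hbound : ∀ m k, 1 ≤ k → N ≤ k + m → ‖u k‖ ≤ ε * E k ∧ ‖v k‖ ≤ ε * E k := by
      intro m
      induction m with
      | zero =>
        intro k _ hk
        obtain ⟨h₁, h₂⟩ := hN k hk
        have : ε ≤ ε * E k := le_mul_of_one_le_right hε.le (hE_one k)
        exact ⟨h₁.trans this, h₂.trans this⟩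
      | succ m ih =>
        intro k hk hNk
        have h₁ := (ih (k + 1) (by omega) (by omega)).2
        have h₂ := (ih (k + 4) (by omega) (by omega)).1.trans
          (mul_le_mul_of_nonneg_left (hE_anti k) hε.le)
        have step : ∀ γ : ℂ, ‖γ‖ ≤ 2 * r ^ k → ‖v (k + 1) + γ * u (k + 4)‖ ≤ ε * E k := by
          intro γ hγ
          calc ‖v (k + 1) + γ * u (k + 4)‖ ≤ ‖v (k + 1)‖ + ‖γ‖ * ‖u (k + 4)‖ := by
                rw [← norm_mul]; exact norm_add_le _ _
            _ ≤ ε * E (k + 1) + 2 * r ^ k * (ε * E (k + 1)) := by gcongr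
            _ = ε * (E (k + 1) + 2 * r ^ k * E (k + 1)) := by ring
            _ ≤ ε * E k := by gcongr; exact hE_succ k
        exact ⟨hu k hk ▸ step _ (hα k), hv k hk ▸ step _ (hβ k)⟩
    exact (hbound N j hj (by omega)).1
  rw [← norm_le_zero_iff]
  refine le_of_forall_pos_le_add fun ε hε => ?_
  have := key (ε / E j) (div_pos hε (hE_pos j))
  rwa [div_mul_cancel₀ _ (hE_pos j).ne', ← zero_add ε] at this

end QDifferenceSystem

section Multisum

open Filter Topology

theorem qPoch_self_succ (a : ℂ) (n : ℕ) :
    qPoch a a (n + 1) = qPoch a a n * (1 - a ^ (n + 1)) := by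
  rw [qPoch, Finset.prod_range_succ, ← qPoch, pow_succ']

theorem one_sub_pow_ne_zero {a : ℂ} (ha : ‖a‖ < 1) (n : ℕ) : 1 - a ^ (n + 1) ≠ 0 := by
  intro h
  have h₁ : ‖a‖ ^ (n + 1) = 1 := by rw [← norm_pow, ← sub_eq_zero.1 h, norm_one]
  exact (pow_lt_one₀ (norm_nonneg a) ha n.succ_ne_zero).ne h₁

theorem qPoch_self_ne_zero {a : ℂ} (ha : ‖a‖ < 1) (n : ℕ) : qPoch a a n ≠ 0 := by
  induction n with
  | zero => simp [qPoch]
  | succ n ih => rw [qPoch_self_succ]; exact mul_ne_zero ih (one_sub_pow_ne_zero ha n)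

theorem summable_pow_div_norm_qPoch {r : ℝ} (hr₀ : 0 ≤ r) (hr : r < 1) {a : ℂ} (ha : ‖a‖ < 1) :
    Summable fun n : ℕ => r ^ n / ‖qPoch a a n‖ := by
  obtain ⟨s, hrs, hs⟩ := exists_between hr
  refine summable_of_ratio_norm_eventually_le hs ?_
  have hlim : Tendsto (fun n : ℕ => r / ‖1 - a ^ (n + 1)‖) atTop (𝓝 (r / ‖(1 : ℂ) - 0‖)) := by
    refine tendsto_const_nhds.div (Tendsto.norm (tendsto_const_nhds.sub ?_)) (by simp)
    exact (tendsto_pow_atTop_nhds_zero_of_norm_lt_one ha).comp (tendsto_add_atTop_nat 1)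
  rw [sub_zero, norm_one, div_one] at hlim
  filter_upwards [hlim.eventually_le_const hrs] with n hn
  have h : r ^ (n + 1) / ‖qPoch a a (n + 1)‖ =
      r / ‖1 - a ^ (n + 1)‖ * (r ^ n / ‖qPoch a a n‖) := by
    rw [qPoch_self_succ, norm_mul, div_mul_div_comm, pow_succ', mul_comm ‖qPoch a a n‖]
  rw [h, norm_mul, Real.norm_of_nonneg (by positivity : 0 ≤ r / ‖1 - a ^ (n + 1)‖)]
  gcongr

/-- The summand of the quadruple series with linear exponent `a n₁ + b n₂ + c n₃ + d n₄`. -/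
noncomputable def multisumTerm (q x y₁ y₂ z : ℂ) (a b c d : ℕ) (n : ℕ × ℕ × ℕ × ℕ) : ℂ :=
  x ^ (n.1 + n.2.1 + n.2.2.1 + n.2.2.2) * y₁ ^ n.2.2.1 * y₂ ^ n.2.2.2 * z ^ n.2.1 *
    q ^ (Qform n.1 n.2.1 n.2.2.1 n.2.2.2 + a * n.1 + b * n.2.1 + c * n.2.2.1 + d * n.2.2.2) /
    (qPoch (q ^ 2) (q ^ 2) n.1 * qPoch (q ^ 2) (q ^ 2) n.2.1 *
      qPoch (q ^ 4) (q ^ 4) n.2.2.1 * qPoch (q ^ 4) (q ^ 4) n.2.2.2)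

/-- The quadruple series with linear exponent `a n₁ + b n₂ + c n₃ + d n₄`. -/
noncomputable def multisum (q x y₁ y₂ z : ℂ) (a b c d : ℕ) : ℂ :=
  ∑' n, multisumTerm q x y₁ y₂ z a b c d n

/-- A summable majorant of all the `multisumTerm`s with positive linear coefficients. -/
noncomputable def multisumMajorant (q : ℂ) (n : ℕ × ℕ × ℕ × ℕ) : ℝ :=
  ‖q‖ ^ n.1 / ‖qPoch (q ^ 2) (q ^ 2) n.1‖ * (‖q‖ ^ n.2.1 / ‖qPoch (q ^ 2) (q ^ 2) n.2.1‖ *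
    (‖q‖ ^ n.2.2.1 / ‖qPoch (q ^ 4) (q ^ 4) n.2.2.1‖ *
      (‖q‖ ^ n.2.2.2 / ‖qPoch (q ^ 4) (q ^ 4) n.2.2.2‖)))

theorem norm_pow_lt_one {q : ℂ} (hq : ‖q‖ < 1) {k : ℕ} (hk : k ≠ 0) : ‖q ^ k‖ < 1 := by
  rw [norm_pow]
  exact pow_lt_one₀ (norm_nonneg q) hq hk

theorem summable_multisumMajorant {q : ℂ} (hq : ‖q‖ < 1) : Summable (multisumMajorant q) := by
  have h₂ := summable_pow_div_norm_qPoch (norm_nonneg q) hq (norm_pow_lt_one hq two_ne_zero)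
  have h₄ := summable_pow_div_norm_qPoch (norm_nonneg q) hq (norm_pow_lt_one hq four_ne_zero)
  have hnn : ∀ (a : ℂ), 0 ≤ fun n : ℕ => ‖q‖ ^ n / ‖qPoch a a n‖ := fun a n => by positivity
  exact h₂.mul_of_nonneg (h₂.mul_of_nonneg (h₄.mul_of_nonneg h₄ (hnn _) (hnn _)) (hnn _)
    fun n => mul_nonneg (hnn _ _) (hnn _ _)) (hnn _)
    fun n => mul_nonneg (hnn _ _) (mul_nonneg (hnn _ _) (hnn _ _))

section

variable {q x y₁ y₂ z : ℂ}

theorem norm_multisumTerm_le (hq : ‖q‖ < 1) (hx : ‖x‖ ≤ 1) (hy₁ : ‖y₁‖ ≤ 1) (hy₂ : ‖y₂‖ ≤ 1)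
    (hz : ‖z‖ ≤ 1) {j a b c d : ℕ} (ha : j + 1 ≤ a) (hb : j + 1 ≤ b) (hc : j + 1 ≤ c)
    (hd : j + 1 ≤ d) (n : ℕ × ℕ × ℕ × ℕ) :
    ‖multisumTerm q x y₁ y₂ z a b c d n‖ ≤
      ‖q‖ ^ (j * (n.1 + n.2.1 + n.2.2.1 + n.2.2.2)) * multisumMajorant q n := by
  obtain ⟨n₁, n₂, n₃, n₄⟩ := n
  have hE : (j + 1) * n₁ + (j + 1) * n₂ + (j + 1) * n₃ + (j + 1) * n₄ ≤
      Qform n₁ n₂ n₃ n₄ + a * n₁ + b * n₂ + c * n₃ + d * n₄ := by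
    have h₁ := Nat.mul_le_mul_right n₁ ha
    have h₂ := Nat.mul_le_mul_right n₂ hb
    have h₃ := Nat.mul_le_mul_right n₃ hc
    have h₄ := Nat.mul_le_mul_right n₄ hd
    omega
  have hq' := pow_le_pow_of_le_one (norm_nonneg q) hq.le hE
  have hw : ‖x‖ ^ (n₁ + n₂ + n₃ + n₄) * ‖y₁‖ ^ n₃ * ‖y₂‖ ^ n₄ * ‖z‖ ^ n₂ ≤ 1 := by
    have hpow : ∀ {t : ℂ} (_ : ‖t‖ ≤ 1) (k : ℕ), ‖t‖ ^ k ≤ 1 := fun ht k =>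
      pow_le_one₀ (norm_nonneg _) ht
    exact mul_le_one₀ (mul_le_one₀ (mul_le_one₀ (hpow hx _) (by positivity) (hpow hy₁ _))
      (by positivity) (hpow hy₂ _)) (by positivity) (hpow hz _)
  simp only [multisumTerm, multisumMajorant, norm_div, norm_mul, norm_pow]
  calc _ ≤ 1 * ‖q‖ ^ ((j + 1) * n₁ + (j + 1) * n₂ + (j + 1) * n₃ + (j + 1) * n₄) /
        (‖qPoch (q ^ 2) (q ^ 2) n₁‖ * ‖qPoch (q ^ 2) (q ^ 2) n₂‖ *
          ‖qPoch (q ^ 4) (q ^ 4) n₃‖ * ‖qPoch (q ^ 4) (q ^ 4) n₄‖) := by gcongr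
    _ = _ := by ring

theorem summable_multisumTerm (hq : ‖q‖ < 1) (hx : ‖x‖ ≤ 1) (hy₁ : ‖y₁‖ ≤ 1) (hy₂ : ‖y₂‖ ≤ 1)
    (hz : ‖z‖ ≤ 1) {a b c d : ℕ} (ha : 1 ≤ a) (hb : 1 ≤ b) (hc : 1 ≤ c) (hd : 1 ≤ d) :
    Summable (multisumTerm q x y₁ y₂ z a b c d) := by
  refine (summable_multisumMajorant hq).of_norm_bounded fun n => ?_
  simpa using norm_multisumTerm_le (j := 0) hq hx hy₁ hy₂ hz ha hb hc hd n

theorem tendsto_multisum (hq : ‖q‖ < 1) (hx : ‖x‖ ≤ 1) (hy₁ : ‖y₁‖ ≤ 1) (hy₂ : ‖y₂‖ ≤ 1)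
    (hz : ‖z‖ ≤ 1) {a b c d : ℕ → ℕ} (ha : ∀ j, j ≤ a j) (hb : ∀ j, j ≤ b j)
    (hc : ∀ j, j ≤ c j) (hd : ∀ j, j ≤ d j) :
    Tendsto (fun j => multisum q x y₁ y₂ z (a j) (b j) (c j) (d j)) atTop (𝓝 1) := by
  rw [← tendsto_add_atTop_iff_nat 1]
  have hbound := fun j n => norm_multisumTerm_le (n := n) hq hx hy₁ hy₂ hz
    (ha (j + 1)) (hb (j + 1)) (hc (j + 1)) (hd (j + 1))
  have hM : ∀ n, 0 ≤ multisumMajorant q n := fun n => by unfold multisumMajorant; positivity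
  have h1 : (1 : ℂ) = ∑' n : ℕ × ℕ × ℕ × ℕ, if n = 0 then 1 else 0 := 
    (tsum_ite_eq (0 : ℕ × ℕ × ℕ × ℕ) fun _ => (1 : ℂ)).symm
  rw [h1]
  refine tendsto_tsum_of_dominated_convergence (summable_multisumMajorant hq) (fun n => ?_)
    (Eventually.of_forall fun j n => (hbound j n).trans
      (mul_le_of_le_one_left (hM n) (pow_le_one₀ (norm_nonneg q) hq.le)))
  split_ifs with hn
  · subst hn
    simp [multisumTerm, qPoch, Qform]
  · refine squeeze_zero_norm (hbound · n) ?_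
    rw [← zero_mul (multisumMajorant q n)]
    refine Tendsto.mul_const _ ?_
    have hs : n.1 + n.2.1 + n.2.2.1 + n.2.2.2 ≠ 0 := fun h => hn (by
      ext <;> simp <;> omega)
    simp_rw [mul_comm _ (n.1 + n.2.1 + n.2.2.1 + n.2.2.2), pow_mul]
    exact tendsto_pow_atTop_nhds_zero_of_lt_one (by positivity)
      (pow_lt_one₀ (norm_nonneg q) hq hs)

theorem tsum_eq_add_mul_tsum_of_injective {ι : Type*} {e : ι → ι} (he : e.Injective)
    {F F' G : ι → ℂ} (hF : Summable F) (hF' : Summable F') {k : ℂ}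
    (h₀ : ∀ n ∉ Set.range e, F n = F' n) (h₁ : ∀ n, F (e n) - F' (e n) = k * G n) :
    ∑' n, F n = ∑' n, F' n + k * ∑' n, G n := by
  have hsupp : Function.support (fun n => F n - F' n) ⊆ Set.range e := fun n hn => by
    by_contra h
    exact hn (sub_eq_zero.2 (h₀ n h))
  rw [← tsum_mul_left, ← sub_eq_iff_eq_add', ← hF.tsum_sub hF', ← he.tsum_eq hsupp]
  exact tsum_congr h₁

theorem multisum_step₁ (hq : ‖q‖ < 1) (hx : ‖x‖ ≤ 1) (hy₁ : ‖y₁‖ ≤ 1) (hy₂ : ‖y₂‖ ≤ 1)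
    (hz : ‖z‖ ≤ 1) {a b c d : ℕ} (ha : 1 ≤ a) (hb : 1 ≤ b) (hc : 1 ≤ c) (hd : 1 ≤ d) :
    multisum q x y₁ y₂ z a b c d = multisum q x y₁ y₂ z (a + 2) b c d +
      x * q ^ a * multisum q x y₁ y₂ z (a + 4) (b + 4) (c + 4) (d + 4) := by
  have h₂ := norm_pow_lt_one hq two_ne_zero
  have h₄ := norm_pow_lt_one hq four_ne_zero
  refine tsum_eq_add_mul_tsum_of_injective (e := fun n => (n.1 + 1, n.2))
    (fun m n h => by simpa [Prod.ext_iff] using h)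
    (summable_multisumTerm hq hx hy₁ hy₂ hz ha hb hc hd)
    (summable_multisumTerm hq hx hy₁ hy₂ hz (by omega) hb hc hd) ?_ ?_
  · rintro ⟨_ | n₁, n₂, n₃, n₄⟩ h
    · simp [multisumTerm]
    · exact absurd ⟨(n₁, n₂, n₃, n₄), rfl⟩ h
  · rintro ⟨n₁, n₂, n₃, n₄⟩
    have hQ : Qform (n₁ + 1) n₂ n₃ n₄ =
        Qform n₁ n₂ n₃ n₄ + (4 * (n₁ + n₂ + n₃ + n₄)) := by
      simp only [Qform, Nat.choose_succ_succ' n₁ 1, Nat.choose_one_right]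
      ring
    simp only [multisumTerm, hQ, qPoch_self_succ]
    have := qPoch_self_ne_zero h₂ n₁
    have := qPoch_self_ne_zero h₂ n₂
    have := qPoch_self_ne_zero h₄ n₃
    have := qPoch_self_ne_zero h₄ n₄
    have := one_sub_pow_ne_zero h₂ n₁
    field_simp
    ring

theorem multisum_step₂ (hq : ‖q‖ < 1) (hx : ‖x‖ ≤ 1) (hy₁ : ‖y₁‖ ≤ 1) (hy₂ : ‖y₂‖ ≤ 1)
    (hz : ‖z‖ ≤ 1) {a b c d : ℕ} (ha : 1 ≤ a) (hb : 1 ≤ b) (hc : 1 ≤ c) (hd : 1 ≤ d) :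
    multisum q x y₁ y₂ z a b c d = multisum q x y₁ y₂ z a (b + 2) c d +
      x * z * q ^ b * multisum q x y₁ y₂ z (a + 4) (b + 6) (c + 4) (d + 4) := by
  have h₂ := norm_pow_lt_one hq two_ne_zero
  have h₄ := norm_pow_lt_one hq four_ne_zero
  refine tsum_eq_add_mul_tsum_of_injective (e := fun n => (n.1, n.2.1 + 1, n.2.2))
    (fun m n h => by simpa [Prod.ext_iff] using h)
    (summable_multisumTerm hq hx hy₁ hy₂ hz ha hb hc hd)
    (summable_multisumTerm hq hx hy₁ hy₂ hz ha (by omega) hc hd) ?_ ?_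
  · rintro ⟨n₁, _ | n₂, n₃, n₄⟩ h
    · simp [multisumTerm]
    · exact absurd ⟨(n₁, n₂, n₃, n₄), rfl⟩ h
  · rintro ⟨n₁, n₂, n₃, n₄⟩
    have hQ : Qform n₁ (n₂ + 1) n₃ n₄ =
        Qform n₁ n₂ n₃ n₄ + (4 * (n₁ + n₂ + n₃ + n₄) + 2 * n₂) := by
      simp only [Qform, Nat.choose_succ_succ' n₂ 1, Nat.choose_one_right]
      ring
    simp only [multisumTerm, hQ, qPoch_self_succ]
    have := qPoch_self_ne_zero h₂ n₁
    have := qPoch_self_ne_zero h₂ n₂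
    have := qPoch_self_ne_zero h₄ n₃
    have := qPoch_self_ne_zero h₄ n₄
    have := one_sub_pow_ne_zero h₂ n₂
    field_simp
    ring

theorem multisum_step₃ (hq : ‖q‖ < 1) (hx : ‖x‖ ≤ 1) (hy₁ : ‖y₁‖ ≤ 1) (hy₂ : ‖y₂‖ ≤ 1)
    (hz : ‖z‖ ≤ 1) {a b c d : ℕ} (ha : 1 ≤ a) (hb : 1 ≤ b) (hc : 1 ≤ c) (hd : 1 ≤ d) :
    multisum q x y₁ y₂ z a b c d = multisum q x y₁ y₂ z a b (c + 4) d +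
      x * y₁ * q ^ c * multisum q x y₁ y₂ z (a + 4) (b + 4) (c + 4) (d + 4) := by
  have h₂ := norm_pow_lt_one hq two_ne_zero
  have h₄ := norm_pow_lt_one hq four_ne_zero
  refine tsum_eq_add_mul_tsum_of_injective (e := fun n => (n.1, n.2.1, n.2.2.1 + 1, n.2.2.2))
    (fun m n h => by simpa [Prod.ext_iff] using h)
    (summable_multisumTerm hq hx hy₁ hy₂ hz ha hb hc hd)
    (summable_multisumTerm hq hx hy₁ hy₂ hz ha hb (by omega) hd) ?_ ?_
  · rintro ⟨n₁, n₂, _ | n₃, n₄⟩ h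
    · simp [multisumTerm]
    · exact absurd ⟨(n₁, n₂, n₃, n₄), rfl⟩ h
  · rintro ⟨n₁, n₂, n₃, n₄⟩
    have hQ : Qform n₁ n₂ (n₃ + 1) n₄ =
        Qform n₁ n₂ n₃ n₄ + (4 * (n₁ + n₂ + n₃ + n₄)) := by
      simp only [Qform, Nat.choose_succ_succ' n₃ 1, Nat.choose_one_right]
      ring
    simp only [multisumTerm, hQ, qPoch_self_succ]
    have := qPoch_self_ne_zero h₂ n₁
    have := qPoch_self_ne_zero h₂ n₂
    have := qPoch_self_ne_zero h₄ n₃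
    have := qPoch_self_ne_zero h₄ n₄
    have := one_sub_pow_ne_zero h₄ n₃
    field_simp
    ring

theorem multisum_step₄ (hq : ‖q‖ < 1) (hx : ‖x‖ ≤ 1) (hy₁ : ‖y₁‖ ≤ 1) (hy₂ : ‖y₂‖ ≤ 1)
    (hz : ‖z‖ ≤ 1) {a b c d : ℕ} (ha : 1 ≤ a) (hb : 1 ≤ b) (hc : 1 ≤ c) (hd : 1 ≤ d) :
    multisum q x y₁ y₂ z a b c d = multisum q x y₁ y₂ z a b c (d + 4) +
      x * y₂ * q ^ d * multisum q x y₁ y₂ z (a + 4) (b + 4) (c + 4) (d + 8) := by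
  have h₂ := norm_pow_lt_one hq two_ne_zero
  have h₄ := norm_pow_lt_one hq four_ne_zero
  refine tsum_eq_add_mul_tsum_of_injective (e := fun n => (n.1, n.2.1, n.2.2.1, n.2.2.2 + 1))
    (fun m n h => by simpa [Prod.ext_iff] using h)
    (summable_multisumTerm hq hx hy₁ hy₂ hz ha hb hc hd)
    (summable_multisumTerm hq hx hy₁ hy₂ hz ha hb hc (by omega)) ?_ ?_
  · rintro ⟨n₁, n₂, n₃, _ | n₄⟩ h
    · simp [multisumTerm]
    · exact absurd ⟨(n₁, n₂, n₃, n₄), rfl⟩ h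
  · rintro ⟨n₁, n₂, n₃, n₄⟩
    have hQ : Qform n₁ n₂ n₃ (n₄ + 1) =
        Qform n₁ n₂ n₃ n₄ + (4 * (n₁ + n₂ + n₃ + n₄) + 4 * n₄) := by
      simp only [Qform, Nat.choose_succ_succ' n₄ 1, Nat.choose_one_right]
      ring
    simp only [multisumTerm, hQ, qPoch_self_succ]
    have := qPoch_self_ne_zero h₂ n₁
    have := qPoch_self_ne_zero h₂ n₂
    have := qPoch_self_ne_zero h₄ n₃
    have := qPoch_self_ne_zero h₄ n₄
    have := one_sub_pow_ne_zero h₄ n₄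
    field_simp
    ring

end

end Multisum

section Overpartition

open Filter Topology

/-- The overpartitions in `𝒜` with all parts at least `j`. -/
def partsFrom (j : ℕ) : Set (Finset ℕ × Finset ℕ) :=
  {p | MemA p.1 p.2 ∧ ∀ a ∈ p.1, j ≤ a}

/-- The overpartitions in `partsFrom j` that may follow a part `j - 4`. -/
def partsAfter (j : ℕ) : Set (Finset ℕ × Finset ℕ) :=
  {p | p ∈ partsFrom j ∧ j ∉ p.2 ∧ (4 ∣ j → j ∉ p.1)}

/-- The contribution of an overpartition to the generating function. -/
noncomputable def overWeight (q x y₁ y₂ z : ℂ) (p : Finset ℕ × Finset ℕ) : ℂ :=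
  x ^ p.1.card * y₁ ^ countMod 2 4 p.1 * y₂ ^ countMod 0 4 p.1 * z ^ p.2.card * q ^ p.1.sum id

/-- The contribution of a single part that is not overlined. -/
noncomputable def partWeight (q x y₁ y₂ : ℂ) (j : ℕ) : ℂ :=
  x * q ^ j * (if j % 4 = 2 then y₁ else 1) * (if j % 4 = 0 then y₂ else 1)

theorem insert_mem_partsFrom {j : ℕ} (hj : 1 ≤ j) {p : Finset ℕ × Finset ℕ}
    (hp : p ∈ partsAfter (j + 4)) : (insert j p.1, p.2) ∈ partsFrom j := by
  obtain ⟨⟨⟨h₁, h₂, h₃, h₄⟩, h₅⟩, h₆, h₇⟩ := hp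
  have hjO : j ∉ p.2 := fun h => by have := h₅ j (h₂ h); omega
  refine ⟨⟨?_, fun a ha => Finset.mem_insert_of_mem (h₂ ha), h₃, ?_⟩, ?_⟩
  · simp only [Finset.mem_insert]
    rintro a (rfl | ha)
    exacts [hj, h₁ a ha]
  · simp only [Finset.mem_insert]
    rintro a (rfl | ha) b (rfl | hb) hab
    · omega
    · have := h₅ b hb; omega
    · have := h₅ a ha
      refine ⟨by omega, fun h => ?_⟩
      by_contra hlt
      obtain rfl : a = b + 4 := by omega
      exact h.elim h₆ fun h => h₇ h ha
    · exact h₄ a ha b hb hab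
  · simp only [Finset.mem_insert]
    rintro a (rfl | ha)
    · exact le_rfl
    · have := h₅ a ha; omega

theorem insert_insert_mem_partsFrom {j : ℕ} (hj : Odd j) {p : Finset ℕ × Finset ℕ}
    (hp : p ∈ partsAfter (j + 4)) : (insert j p.1, insert j p.2) ∈ partsFrom j := by
  obtain ⟨⟨h₁, h₂, h₃, h₄⟩, h₅⟩ := insert_mem_partsFrom hj.pos hp
  refine ⟨⟨h₁, Finset.insert_subset (Finset.mem_insert_self _ _) h₂, ?_, ?_⟩, h₅⟩
  · simp only [Finset.mem_insert]
    rintro a (rfl | ha)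
    exacts [hj, h₃ a ha]
  · intro a ha b hb hab
    have hja : j ≠ a := by have := h₅ b hb; omega
    have := h₄ a ha b hb hab
    rwa [Finset.mem_insert, or_iff_right hja.symm]

theorem erase_mem_partsAfter {j : ℕ} {p : Finset ℕ × Finset ℕ} (hp : p ∈ partsFrom j)
    (hjp : j ∈ p.1) : (p.1.erase j, p.2.erase j) ∈ partsAfter (j + 4) := by
  obtain ⟨⟨h₁, h₂, h₃, h₄⟩, h₅⟩ := hp
  have hlt : ∀ a ∈ p.1.erase j, j < a := fun a ha =>
    lt_of_le_of_ne (h₅ a (Finset.mem_of_mem_erase ha)) (Finset.ne_of_mem_erase ha).symm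
  refine ⟨⟨⟨fun a ha => h₁ a (Finset.mem_of_mem_erase ha), Finset.erase_subset_erase _ h₂,
    fun a ha => h₃ a (Finset.mem_of_mem_erase ha), ?_⟩, ?_⟩, ?_, ?_⟩
  · intro a ha b hb hab
    have := h₄ a (Finset.mem_of_mem_erase ha) b (Finset.mem_of_mem_erase hb) hab
    exact ⟨this.1, fun h => this.2 (h.imp_left Finset.mem_of_mem_erase)⟩
  · intro a ha
    have := (h₄ a (Finset.mem_of_mem_erase ha) j hjp (hlt a ha)).1
    have := hlt a ha
    omega
  · intro h
    have hO := Finset.mem_of_mem_erase h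
    have := (h₄ _ (h₂ hO) j hjp (by omega)).2 (Or.inl hO)
    omega
  · intro hd h
    have := (h₄ _ (Finset.mem_of_mem_erase h) j hjp (by omega)).2 (Or.inr hd)
    omega

theorem partsFrom_succ {j : ℕ} : partsFrom (j + 1) = {p | p ∈ partsFrom j ∧ j ∉ p.1} := by
  ext p
  refine ⟨fun ⟨h, h'⟩ => ⟨⟨h, fun a ha => (Nat.le_succ j).trans (h' a ha)⟩, fun hj => ?_⟩,
    fun ⟨⟨h, h'⟩, hj⟩ => ⟨h, fun a ha => ?_⟩⟩
  · have := h' j hj; omega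
  · have := h' a ha
    have : a ≠ j := fun h => hj (h ▸ ha)
    omega

theorem image_insert_partsAfter {j : ℕ} (hj : 1 ≤ j) :
    (fun p : Finset ℕ × Finset ℕ => (insert j p.1, p.2)) '' partsAfter (j + 4) =
      {p | p ∈ partsFrom j ∧ j ∈ p.1 ∧ j ∉ p.2} := by
  ext p
  constructor
  · rintro ⟨p, hp, rfl⟩
    refine ⟨insert_mem_partsFrom hj hp, Finset.mem_insert_self _ _, fun h => ?_⟩
    have := hp.1.2 j (hp.1.1.2.1 h)
    omega
  · rintro ⟨hp, hjP, hjO⟩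
    refine ⟨_, erase_mem_partsAfter hp hjP, ?_⟩
    simp [Finset.insert_erase hjP, Finset.erase_eq_of_notMem hjO]

theorem image_insert_insert_partsAfter {j : ℕ} (hj : Odd j) :
    (fun p : Finset ℕ × Finset ℕ => (insert j p.1, insert j p.2)) '' partsAfter (j + 4) =
      {p | p ∈ partsFrom j ∧ j ∈ p.2} := by
  ext p
  constructor
  · rintro ⟨p, hp, rfl⟩
    exact ⟨insert_insert_mem_partsFrom hj hp, Finset.mem_insert_self _ _⟩
  · rintro ⟨hp, hjO⟩
    have hjP := hp.1.2.1 hjO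
    refine ⟨_, erase_mem_partsAfter hp hjP, ?_⟩
    simp [Finset.insert_erase hjP, Finset.insert_erase hjO]

theorem notMem_of_mem_partsAfter {j : ℕ} {p : Finset ℕ × Finset ℕ}
    (hp : p ∈ partsAfter (j + 4)) : j ∉ p.1 ∧ j ∉ p.2 := by
  have h : j ∉ p.1 := fun h => by have := hp.1.2 j h; omega
  exact ⟨h, fun h' => h (hp.1.1.2.1 h')⟩

section

variable {q x y₁ y₂ z : ℂ}

theorem overWeight_insert {j : ℕ} {p : Finset ℕ × Finset ℕ} (hp : j ∉ p.1) :
    overWeight q x y₁ y₂ z (insert j p.1, p.2) =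
      partWeight q x y₁ y₂ j * overWeight q x y₁ y₂ z p := by
  have hcount : ∀ (a : ℕ) (y : ℂ), y ^ countMod a 4 (insert j p.1) =
      (if j % 4 = a then y else 1) * y ^ countMod a 4 p.1 := by
    intro a y
    rw [countMod, countMod, Finset.filter_insert]
    split_ifs
    · rw [Finset.card_insert_of_notMem (by simp [hp]), pow_succ']
    · rw [one_mul]
  simp only [overWeight, partWeight, hcount, Finset.card_insert_of_notMem hp,
    Finset.sum_insert hp, id, pow_add, pow_one]
  ring

theorem overWeight_insert_insert {j : ℕ} {p : Finset ℕ × Finset ℕ} (hp : j ∉ p.1)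
    (hp' : j ∉ p.2) :
    overWeight q x y₁ y₂ z (insert j p.1, insert j p.2) =
      z * partWeight q x y₁ y₂ j * overWeight q x y₁ y₂ z p := by
  rw [mul_assoc, ← overWeight_insert hp, overWeight, overWeight,
    Finset.card_insert_of_notMem hp']
  ring

theorem norm_overWeight_le (hx : ‖x‖ ≤ 1) (hy₁ : ‖y₁‖ ≤ 1) (hy₂ : ‖y₂‖ ≤ 1) (hz : ‖z‖ ≤ 1)
    (p : Finset ℕ × Finset ℕ) : ‖overWeight q x y₁ y₂ z p‖ ≤ ‖q‖ ^ p.1.sum id := by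
  have hpow : ∀ {t : ℂ} (_ : ‖t‖ ≤ 1) (k : ℕ), ‖t‖ ^ k ≤ 1 := fun ht k =>
    pow_le_one₀ (norm_nonneg _) ht
  simp only [overWeight, norm_mul, norm_pow]
  exact mul_le_of_le_one_left (by positivity) <|
    mul_le_one₀ (mul_le_one₀ (mul_le_one₀ (hpow hx _) (by positivity) (hpow hy₁ _))
      (by positivity) (hpow hy₂ _)) (by positivity) (hpow hz _)

theorem summable_pow_sum_indicator {r : ℝ} (hr₀ : 0 ≤ r) (hr : r < 1) :
    Summable ({p : Finset ℕ × Finset ℕ | p.2 ⊆ p.1}.indicator fun p => r ^ p.1.sum id) := by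
  rw [← summable_subtype_iff_indicator]
  have h₁ : Summable fun s : Finset ℕ => r ^ s.sum id := by
    refine (summable_finsetProd_of_summable_nonneg (fun i => pow_nonneg hr₀ i)
      (summable_geometric_of_lt_one hr₀ hr)).congr fun s => ?_
    exact Finset.prod_pow_eq_pow_sum s id r
  have hnn : 0 ≤ fun s : Finset ℕ => r ^ s.sum id := fun s => pow_nonneg hr₀ _
  have h₂ := h₁.mul_of_nonneg h₁ hnn hnn
  have hinj : Function.Injective fun p : {p : Finset ℕ × Finset ℕ | p.2 ⊆ p.1} =>
      (p.1.1 \ p.1.2, p.1.2) := by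
    rintro ⟨⟨P, O⟩, h⟩ ⟨⟨P', O'⟩, h'⟩ heq
    simp only [Prod.mk.injEq, Set.mem_ofPred_eq] at heq h h'
    obtain ⟨h₁, rfl⟩ := heq
    have : P = P' := by rw [← Finset.sdiff_union_of_subset h, h₁, Finset.sdiff_union_of_subset h']
    simp [this]
  refine (h₂.comp_injective hinj).congr fun p => ?_
  simp only [Function.comp_apply, ← pow_add]
  rw [Finset.sum_sdiff p.2]

theorem norm_indicator_overWeight_le (hx : ‖x‖ ≤ 1) (hy₁ : ‖y₁‖ ≤ 1) (hy₂ : ‖y₂‖ ≤ 1)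
    (hz : ‖z‖ ≤ 1) {T : Set (Finset ℕ × Finset ℕ)} (hT : ∀ p ∈ T, p.2 ⊆ p.1)
    (p : Finset ℕ × Finset ℕ) : ‖T.indicator (overWeight q x y₁ y₂ z) p‖ ≤
      {p : Finset ℕ × Finset ℕ | p.2 ⊆ p.1}.indicator (fun p => ‖q‖ ^ p.1.sum id) p := by
  rw [norm_indicator_eq_indicator_norm]
  refine (Set.indicator_le_indicator (g := fun p : Finset ℕ × Finset ℕ => ‖q‖ ^ p.1.sum id)
    (norm_overWeight_le hx hy₁ hy₂ hz p)).trans ?_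
  exact Set.indicator_le_indicator_of_subset hT (fun _ => by positivity) p

theorem summable_overWeight (hq : ‖q‖ < 1) (hx : ‖x‖ ≤ 1) (hy₁ : ‖y₁‖ ≤ 1) (hy₂ : ‖y₂‖ ≤ 1)
    (hz : ‖z‖ ≤ 1) {T : Set (Finset ℕ × Finset ℕ)} (hT : ∀ p ∈ T, p.2 ⊆ p.1) :
    Summable fun p : T => overWeight q x y₁ y₂ z p :=
  summable_subtype_iff_indicator.2 <|
    (summable_pow_sum_indicator (norm_nonneg q) hq).of_norm_bounded
      (norm_indicator_overWeight_le hx hy₁ hy₂ hz hT)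

theorem empty_mem_partsAfter (j : ℕ) : ((∅, ∅) : Finset ℕ × Finset ℕ) ∈ partsAfter j := by
  simp [partsAfter, partsFrom, MemA]

theorem tendsto_tsum_overWeight (hq : ‖q‖ < 1) (hx : ‖x‖ ≤ 1) (hy₁ : ‖y₁‖ ≤ 1)
    (hy₂ : ‖y₂‖ ≤ 1) (hz : ‖z‖ ≤ 1) {T : ℕ → Set (Finset ℕ × Finset ℕ)}
    (hT₀ : ∀ j, (∅, ∅) ∈ T j) (hT : ∀ j, T j ⊆ partsFrom j) :
    Tendsto (fun j => ∑' p : T j, overWeight q x y₁ y₂ z p) atTop (𝓝 1) := by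
  have h1 : (1 : ℂ) = ∑' p : Finset ℕ × Finset ℕ, if p = (∅, ∅) then 1 else 0 :=
    (tsum_ite_eq ((∅, ∅) : Finset ℕ × Finset ℕ) fun _ => (1 : ℂ)).symm
  simp_rw [tsum_subtype]
  rw [h1]
  refine tendsto_tsum_of_dominated_convergence
    (summable_pow_sum_indicator (norm_nonneg q) hq) (fun p => ?_)
    (Eventually.of_forall fun j p => norm_indicator_overWeight_le hx hy₁ hy₂ hz
      (fun p hp => (hT j hp).1.2.1) p)
  split_ifs with hp
  · subst hp
    simp [Set.indicator_of_mem (hT₀ _), overWeight, countMod]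
  · refine tendsto_const_nhds.congr' ?_
    filter_upwards [eventually_gt_atTop (p.1.sup id)] with j hj
    refine (Set.indicator_of_notMem (fun h => hp ?_) _).symm
    obtain ⟨⟨-, hO, -⟩, hP⟩ := hT j h
    have hP' : p.1 = ∅ := Finset.eq_empty_of_forall_notMem fun a ha =>
      absurd (hP a ha) (not_le.2 ((Finset.le_sup (f := id) ha).trans_lt hj))
    exact Prod.ext hP' (Finset.subset_empty.1 (hP' ▸ hO))

theorem tsum_image_insert (j : ℕ) :
    ∑' p : (fun p : Finset ℕ × Finset ℕ => (insert j p.1, p.2)) '' partsAfter (j + 4),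
        overWeight q x y₁ y₂ z p =
      partWeight q x y₁ y₂ j * ∑' p : partsAfter (j + 4), overWeight q x y₁ y₂ z p := by
  rw [tsum_image, ← tsum_mul_left]
  · exact tsum_congr fun p => overWeight_insert (notMem_of_mem_partsAfter p.2).1
  · rintro p hp p' hp' h
    simp only [Prod.mk.injEq] at h
    refine Prod.ext ?_ h.2
    rw [← Finset.erase_insert (notMem_of_mem_partsAfter hp).1, h.1,
      Finset.erase_insert (notMem_of_mem_partsAfter hp').1]

theorem tsum_image_insert_insert (j : ℕ) :
    ∑' p : (fun p : Finset ℕ × Finset ℕ => (insert j p.1, insert j p.2)) '' partsAfter (j + 4),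
        overWeight q x y₁ y₂ z p =
      z * partWeight q x y₁ y₂ j *
        ∑' p : partsAfter (j + 4), overWeight q x y₁ y₂ z p := by
  rw [tsum_image, ← tsum_mul_left]
  · exact tsum_congr fun p => overWeight_insert_insert (notMem_of_mem_partsAfter p.2).1
      (notMem_of_mem_partsAfter p.2).2
  · rintro p hp p' hp' h
    simp only [Prod.mk.injEq] at h
    refine Prod.ext ?_ ?_
    · rw [← Finset.erase_insert (notMem_of_mem_partsAfter hp).1, h.1,
        Finset.erase_insert (notMem_of_mem_partsAfter hp').1]
    · rw [← Finset.erase_insert (notMem_of_mem_partsAfter hp).2, h.2,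
        Finset.erase_insert (notMem_of_mem_partsAfter hp').2]

theorem tsum_overWeight_union (hq : ‖q‖ < 1) (hx : ‖x‖ ≤ 1) (hy₁ : ‖y₁‖ ≤ 1) (hy₂ : ‖y₂‖ ≤ 1)
    (hz : ‖z‖ ≤ 1) {S T U : Set (Finset ℕ × Finset ℕ)} (hU : ∀ p ∈ U, p.2 ⊆ p.1)
    (h : U = S ∪ T) (hd : Disjoint S T) :
    ∑' p : U, overWeight q x y₁ y₂ z p =
      ∑' p : S, overWeight q x y₁ y₂ z p + ∑' p : T, overWeight q x y₁ y₂ z p := by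
  subst h
  exact (summable_overWeight hq hx hy₁ hy₂ hz fun p hp => hU p (Or.inl hp)).tsum_union_disjoint hd
    (summable_overWeight hq hx hy₁ hy₂ hz fun p hp => hU p (Or.inr hp))

theorem tsum_partsAfter (hq : ‖q‖ < 1) (hx : ‖x‖ ≤ 1) (hy₁ : ‖y₁‖ ≤ 1) (hy₂ : ‖y₂‖ ≤ 1)
    (hz : ‖z‖ ≤ 1) {j : ℕ} (hj : 1 ≤ j) :
    ∑' p : partsAfter j, overWeight q x y₁ y₂ z p =
      ∑' p : partsFrom (j + 1), overWeight q x y₁ y₂ z p +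
        (if 4 ∣ j then 0 else partWeight q x y₁ y₂ j) *
          ∑' p : partsAfter (j + 4), overWeight q x y₁ y₂ z p := by
  have hsub : ∀ p ∈ partsFrom j, p.2 ⊆ p.1 := fun p hp => hp.1.2.1
  split_ifs with h4
  · have : partsAfter j = partsFrom (j + 1) := by
      rw [partsFrom_succ]
      ext p
      exact ⟨fun h => ⟨h.1, h.2.2 h4⟩, fun h => ⟨h.1, fun h' => h.2 (hsub p h.1 h'), fun _ => h.2⟩⟩
    rw [this, zero_mul, add_zero]
  · rw [← tsum_image_insert]
    refine tsum_overWeight_union hq hx hy₁ hy₂ hz (fun p hp => hsub p hp.1) ?_ ?_ <;>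
      rw [image_insert_partsAfter hj, partsFrom_succ]
    · ext p
      have := hsub p
      simp only [partsAfter, h4, Set.mem_union, Set.mem_ofPred_eq]
      grind
    · exact Set.disjoint_left.2 fun p h h' => h.2 h'.2.1

theorem tsum_partsFrom (hq : ‖q‖ < 1) (hx : ‖x‖ ≤ 1) (hy₁ : ‖y₁‖ ≤ 1) (hy₂ : ‖y₂‖ ≤ 1)
    (hz : ‖z‖ ≤ 1) {j : ℕ} (hj : 1 ≤ j) :
    ∑' p : partsFrom j, overWeight q x y₁ y₂ z p =
      ∑' p : partsFrom (j + 1), overWeight q x y₁ y₂ z p +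
        (partWeight q x y₁ y₂ j + if Odd j then z * partWeight q x y₁ y₂ j else 0) *
          ∑' p : partsAfter (j + 4), overWeight q x y₁ y₂ z p := by
  have hsub : ∀ p ∈ partsFrom j, p.2 ⊆ p.1 := fun p hp => hp.1.2.1
  have hO : ∑' p : {p | p ∈ partsFrom j ∧ j ∈ p.2}, overWeight q x y₁ y₂ z p =
      (if Odd j then z * partWeight q x y₁ y₂ j else 0) *
        ∑' p : partsAfter (j + 4), overWeight q x y₁ y₂ z p := by
    split_ifs with hodd
    · rw [← tsum_image_insert_insert, image_insert_insert_partsAfter hodd]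
    · have : {p | p ∈ partsFrom j ∧ j ∈ p.2} = ∅ :=
        Set.eq_empty_of_forall_notMem fun p hp => hodd (hp.1.1.2.2.1 j hp.2)
      rw [this, tsum_empty, zero_mul]
  rw [add_mul, ← hO, ← tsum_image_insert, image_insert_partsAfter hj]
  rw [← tsum_overWeight_union hq hx hy₁ hy₂ hz (U := {p | p ∈ partsFrom j ∧ j ∈ p.1})
    (fun p hp => hsub p hp.1)]
  · refine tsum_overWeight_union hq hx hy₁ hy₂ hz hsub ?_ ?_ <;> rw [partsFrom_succ]
    · ext p
      simp only [Set.mem_union, Set.mem_ofPred_eq]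
      tauto
    · exact Set.disjoint_left.2 fun p h h' => h.2 h'.2
  · ext p
    have := hsub p
    simp only [Set.mem_union, Set.mem_ofPred_eq]
    grind
  · exact Set.disjoint_left.2 fun p h h' => h.2.2 h'.2

end

end Overpartition

section Comparison

open Filter Topology

variable {q x y₁ y₂ z : ℂ}

/-- The series counterpart of the generating function of `partsFrom j`. -/
noncomputable def multisumFrom (q x y₁ y₂ z : ℂ) (j : ℕ) : ℂ :=
  multisum q x y₁ y₂ z (2 * (j / 2) + 1) (2 * (j / 2) + 1) (4 * ((j + 1) / 4) + 2)
    (4 * ((j + 3) / 4))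

/-- The series counterpart of the generating function of `partsAfter j`. -/
noncomputable def multisumAfter (q x y₁ y₂ z : ℂ) (j : ℕ) : ℂ :=
  multisum q x y₁ y₂ z (2 * (j / 2) + 1) (2 * ((j + 1) / 2) + 1) (4 * ((j + 1) / 4) + 2)
    (4 * ((j + 4) / 4))

theorem multisumAfter_eq (hq : ‖q‖ < 1) (hx : ‖x‖ ≤ 1) (hy₁ : ‖y₁‖ ≤ 1) (hy₂ : ‖y₂‖ ≤ 1)
    (hz : ‖z‖ ≤ 1) {j : ℕ} (hj : 1 ≤ j) :
    multisumAfter q x y₁ y₂ z j = multisumFrom q x y₁ y₂ z (j + 1) +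
      (if 4 ∣ j then 0 else partWeight q x y₁ y₂ j) * multisumAfter q x y₁ y₂ z (j + 4) := by
  simp only [multisumAfter, multisumFrom, partWeight]
  have h : j % 4 = 0 ∨ j % 4 = 2 ∨ j % 2 = 1 := by omega
  rcases h with h | h | h
  · rw [if_pos (by omega), zero_mul, add_zero]
    congr 1 <;> omega
  · rw [if_neg (by omega), if_pos h, if_neg (by omega), multisum_step₃ hq hx hy₁ hy₂ hz
      (by omega) (by omega) (by omega) (by omega)]
    rw [show 4 * ((j + 1) / 4) + 2 = j by omega]
    congr 1
    · congr 1 <;> omega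
    · congr 1
      · ring
      · congr 1 <;> omega
  · rw [if_neg (by omega), if_neg (by omega), if_neg (by omega), multisum_step₁ hq hx hy₁ hy₂ hz
      (by omega) (by omega) (by omega) (by omega)]
    rw [show 2 * (j / 2) + 1 = j by omega]
    congr 1
    · congr 1 <;> omega
    · congr 1
      · ring
      · congr 1 <;> omega

theorem multisumFrom_eq (hq : ‖q‖ < 1) (hx : ‖x‖ ≤ 1) (hy₁ : ‖y₁‖ ≤ 1) (hy₂ : ‖y₂‖ ≤ 1)
    (hz : ‖z‖ ≤ 1) {j : ℕ} (hj : 1 ≤ j) :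
    multisumFrom q x y₁ y₂ z j = multisumFrom q x y₁ y₂ z (j + 1) +
      (partWeight q x y₁ y₂ j + if Odd j then z * partWeight q x y₁ y₂ j else 0) *
        multisumAfter q x y₁ y₂ z (j + 4) := by
  have h : j % 4 = 0 ∨ j % 4 = 2 ∨ j % 2 = 1 := by omega
  rcases h with h | h | h
  · rw [if_neg (by grind)]
    simp only [multisumAfter, multisumFrom, partWeight]
    rw [if_neg (by omega), if_pos h, multisum_step₄ hq hx hy₁ hy₂ hz
      (by omega) (by omega) (by omega) (by omega)]
    rw [show 4 * ((j + 3) / 4) = j by omega]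
    congr 1
    · congr 1 <;> omega
    · congr 1
      · ring
      · congr 1 <;> omega
  · have hA := multisumAfter_eq hq hx hy₁ hy₂ hz hj
    rw [if_neg (by omega)] at hA
    rw [if_neg (by grind), add_zero, ← hA]
    simp only [multisumAfter, multisumFrom]
    congr 1 <;> omega
  · have hA := multisumAfter_eq hq hx hy₁ hy₂ hz hj
    rw [if_neg (by omega)] at hA
    rw [if_pos (Nat.odd_iff.2 h), add_mul, ← add_assoc, ← hA]
    simp only [multisumAfter, multisumFrom, partWeight]
    rw [if_neg (by omega), if_neg (by omega), multisum_step₂ hq hx hy₁ hy₂ hz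
      (by omega) (by omega) (by omega) (by omega)]
    congr 1
    · congr 1 <;> omega
    · congr 1
      · rw [show 2 * (j / 2) + 1 = j by omega]
        ring
      · congr 1 <;> omega

theorem norm_partWeight_le (hx : ‖x‖ ≤ 1) (hy₁ : ‖y₁‖ ≤ 1) (hy₂ : ‖y₂‖ ≤ 1) (j : ℕ) :
    ‖partWeight q x y₁ y₂ j‖ ≤ ‖q‖ ^ j := by
  have h₁ : ‖if j % 4 = 2 then y₁ else 1‖ ≤ 1 := by split_ifs <;> simp [hy₁]
  have h₂ : ‖if j % 4 = 0 then y₂ else 1‖ ≤ 1 := by split_ifs <;> simp [hy₂]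
  rw [partWeight, norm_mul, norm_mul, norm_mul, norm_pow]
  calc _ ≤ 1 * ‖q‖ ^ j * 1 * 1 := by gcongr
    _ = ‖q‖ ^ j := by ring

theorem tsum_partsAfter_eq_multisumAfter (hq : ‖q‖ < 1) (hx : ‖x‖ ≤ 1) (hy₁ : ‖y₁‖ ≤ 1)
    (hy₂ : ‖y₂‖ ≤ 1) (hz : ‖z‖ ≤ 1) {j : ℕ} (hj : 1 ≤ j) :
    ∑' p : partsAfter j, overWeight q x y₁ y₂ z p = multisumAfter q x y₁ y₂ z j := by
  have hw := norm_partWeight_le (q := q) hx hy₁ hy₂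
  have hlim {u v : ℕ → ℂ} (hu : Tendsto u atTop (𝓝 1)) (hv : Tendsto v atTop (𝓝 1)) :
      Tendsto (fun j => u j - v j) atTop (𝓝 0) := by simpa using hu.sub hv
  refine sub_eq_zero.1 (eq_zero_of_recurrence (norm_nonneg q) hq
    (u := fun j => ∑' p : partsAfter j, overWeight q x y₁ y₂ z p - multisumAfter q x y₁ y₂ z j)
    (v := fun j => ∑' p : partsFrom j, overWeight q x y₁ y₂ z p - multisumFrom q x y₁ y₂ z j)
    (α := fun j => if 4 ∣ j then 0 else partWeight q x y₁ y₂ j)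
    (β := fun j => partWeight q x y₁ y₂ j + if Odd j then z * partWeight q x y₁ y₂ j else 0)
    (fun j => ?_) (fun j => ?_) (fun j hj => ?_) (fun j hj => ?_) (hlim ?_ ?_) (hlim ?_ ?_) hj)
  · have := hw j
    have : 0 ≤ ‖q‖ ^ j := by positivity
    split_ifs
    · rw [norm_zero]; positivity
    · linarith
  · have hz' : ‖if Odd j then z * partWeight q x y₁ y₂ j else 0‖ ≤ ‖q‖ ^ j := by
      split_ifs
      · rw [norm_mul]
        exact (mul_le_of_le_one_left (norm_nonneg _) hz).trans (hw j)
      · rw [norm_zero]; positivity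
    rw [two_mul]
    exact norm_add_le_of_le (hw j) hz'
  · rw [tsum_partsAfter hq hx hy₁ hy₂ hz hj, multisumAfter_eq hq hx hy₁ hy₂ hz hj]
    ring
  · rw [tsum_partsFrom hq hx hy₁ hy₂ hz hj, multisumFrom_eq hq hx hy₁ hy₂ hz hj]
    ring
  · exact tendsto_tsum_overWeight hq hx hy₁ hy₂ hz empty_mem_partsAfter fun j p hp => hp.1
  · exact tendsto_multisum hq hx hy₁ hy₂ hz (by omega) (by omega) (by omega) (by omega)
  · exact tendsto_tsum_overWeight hq hx hy₁ hy₂ hz (fun j => (empty_mem_partsAfter j).1)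
      fun j p hp => hp
  · exact tendsto_multisum hq hx hy₁ hy₂ hz (by omega) (by omega) (by omega) (by omega)

theorem partsAfter_one : partsAfter 1 = {p | MemA p.1 p.2 ∧ 1 ∉ p.2} := by
  ext p
  exact ⟨fun h => ⟨h.1.1, h.2.1⟩, fun h => ⟨⟨h.1, h.1.1⟩, h.2, fun h4 => by omega⟩⟩

end Comparison

/-- The quinvariate generating function for `𝒜` for `𝒜_{1̄}` (the part `1̄` forbidden; second identity of Theorem 5.1). -/
theorem genfun_A_no1bar (q x y₁ y₂ z : ℂ) (hq : ‖q‖ < 1)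
    (hx : ‖x‖ ≤ 1) (hy₁ : ‖y₁‖ ≤ 1) (hy₂ : ‖y₂‖ ≤ 1) (hz : ‖z‖ ≤ 1) :
    Summable (fun lam : {p : Finset ℕ × Finset ℕ // MemA p.1 p.2 ∧ 1 ∉ p.2} =>
      x ^ lam.1.1.card * y₁ ^ countMod 2 4 lam.1.1 * y₂ ^ countMod 0 4 lam.1.1 *
        z ^ lam.1.2.card * q ^ lam.1.1.sum id) ∧
    Summable (fun n : ℕ × ℕ × ℕ × ℕ =>
      x ^ (n.1 + n.2.1 + n.2.2.1 + n.2.2.2) * y₁ ^ n.2.2.1 * y₂ ^ n.2.2.2 * z ^ n.2.1 *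
        q ^ (Qform n.1 n.2.1 n.2.2.1 n.2.2.2 + n.1 + 3 * n.2.1 + 2 * n.2.2.1 + 4 * n.2.2.2) /
        (qPoch (q ^ 2) (q ^ 2) n.1 * qPoch (q ^ 2) (q ^ 2) n.2.1 *
          qPoch (q ^ 4) (q ^ 4) n.2.2.1 * qPoch (q ^ 4) (q ^ 4) n.2.2.2)) ∧
    ∑' lam : {p : Finset ℕ × Finset ℕ // MemA p.1 p.2 ∧ 1 ∉ p.2},
        x ^ lam.1.1.card * y₁ ^ countMod 2 4 lam.1.1 * y₂ ^ countMod 0 4 lam.1.1 *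
          z ^ lam.1.2.card * q ^ lam.1.1.sum id =
      ∑' n : ℕ × ℕ × ℕ × ℕ,
        x ^ (n.1 + n.2.1 + n.2.2.1 + n.2.2.2) * y₁ ^ n.2.2.1 * y₂ ^ n.2.2.2 * z ^ n.2.1 *
          q ^ (Qform n.1 n.2.1 n.2.2.1 n.2.2.2 + n.1 + 3 * n.2.1 + 2 * n.2.2.1 + 4 * n.2.2.2) /
          (qPoch (q ^ 2) (q ^ 2) n.1 * qPoch (q ^ 2) (q ^ 2) n.2.1 *
            qPoch (q ^ 4) (q ^ 4) n.2.2.1 * qPoch (q ^ 4) (q ^ 4) n.2.2.2) := by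
  have hsum := summable_overWeight (T := {p | MemA p.1 p.2 ∧ 1 ∉ p.2}) hq hx hy₁ hy₂ hz
    fun p hp => hp.1.2.1
  have hmulti := summable_multisumTerm (a := 1) (b := 3) (c := 2) (d := 4) hq hx hy₁ hy₂ hz
    le_rfl (by norm_num) (by norm_num) (by norm_num)
  have heq := tsum_partsAfter_eq_multisumAfter hq hx hy₁ hy₂ hz le_rfl
  rw [partsAfter_one, show multisumAfter q x y₁ y₂ z 1 = multisum q x y₁ y₂ z 1 3 2 4 from rfl]
    at heq
  simp only [multisum, multisumTerm, one_mul] at heq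
  exact ⟨hsum, hmulti.congr fun n => by simp only [multisumTerm, one_mul], heq⟩
end

section
/- Let q, x, y₁, y₂, z be complex numbers with |q| < 1 and |x|, |y₁|, |y₂|, |z| ≤ 1. Let 𝒜_{1,1̄} = {λ = (P,O) ∈ 𝒜 : 1 ∉ P} (the parts 1 and 1̄ are forbidden). Then Σ_{λ ∈ 𝒜_{1,1̄}} x^{♯(λ)} y₁^{♯_{2,4}(λ)} y₂^{♯_{0,4}(λ)} z^{𝖮(λ)} q^{|λ|} = Σ_{n₁,n₂,n₃,n₄ ≥ 0} x^{n₁+n₂+n₃+n₄} y₁^{n₃} y₂^{n₄} z^{n₂} q^{Q(n₁,n₂,n₃,n₄) + 3n₁ + 3n₂ + 2n₃ + 4n₄} / ((q²;q²)_{n₁}(q²;q²)_{n₂}(q⁴;q⁴)_{n₃}(q⁴;q⁴)_{n₄}), where both series converge absolutely. -/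
open Filter Topology

/-- The linear system satisfied by `u k`, the generating function of the members of `𝒜` with all
parts at least `k`, and `w k`, the generating function of what may follow a smallest part `k`. -/
structure IsRecursiveSystem (q x y₁ y₂ z : ℂ) (u w : ℕ → ℂ) : Prop where
  u_odd : ∀ k, k % 2 = 1 → u k = u (k + 1) + (1 + z) * x * q ^ k * w k
  u_two : ∀ k, k % 4 = 2 → u k = u (k + 1) + x * y₁ * q ^ k * w k
  u_zero : ∀ k, 0 < k → k % 4 = 0 → u k = u (k + 1) + x * y₂ * q ^ k * w k
  w_odd : ∀ k, k % 2 = 1 → w k = u (k + 5) + x * q ^ (k + 4) * w (k + 4)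
  w_two : ∀ k, k % 4 = 2 → w k = u (k + 4)
  w_zero : ∀ k, 0 < k → k % 4 = 0 → w k = u (k + 5)
  tendsto_u : Tendsto u atTop (𝓝 1)
  tendsto_w : Tendsto w atTop (𝓝 1)

/-- A null sequence which is controlled by its later terms up to factors with convergent product
vanishes. -/
lemma nonpos_of_forall_le_one_add_mul {d a : ℕ → ℝ} (ha : ∀ k, 0 ≤ a k) (has : Summable a)
    (hd : Tendsto d atTop (𝓝 0))
    (h : ∀ k, 0 < k → ∀ B, 0 ≤ B → (∀ j, k < j → d j ≤ B) → d k ≤ (1 + a k) * B)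
    {k : ℕ} (hk : 0 < k) : d k ≤ 0 := by
  have key : ∀ N B, 0 ≤ B → (∀ j, N ≤ j → d j ≤ B) → ∀ i m, 0 < m → m + i = N →
      ∀ j, m ≤ j → d j ≤ (∏ l ∈ Finset.Ico m N, (1 + a l)) * B := by
    intro N B hB hN i
    induction i with
    | zero =>
      intro m _ hmN j hj
      obtain rfl : m = N := hmN
      simpa using hN j hj
    | succ i ih =>
      intro m hm hmN j hj
      have ih' := ih (m + 1) (by omega) (by omega)
      have hP : 0 ≤ (∏ l ∈ Finset.Ico (m + 1) N, (1 + a l)) * B :=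
        mul_nonneg (Finset.prod_nonneg fun l _ => by linarith [ha l]) hB
      rw [Finset.prod_eq_prod_Ico_succ_bot (by omega : m < N), mul_assoc]
      rcases hj.eq_or_lt with rfl | hj
      · exact h m hm _ hP fun j hj => ih' j hj
      · exact (ih' j hj).trans (le_mul_of_one_le_left hP (by linarith [ha m]))
  have hC : ∀ ε, 0 < ε → d k ≤ Real.exp (∑' l, a l) * ε := by
    intro ε hε
    obtain ⟨N, hN⟩ := eventually_atTop.1 ((hd.eventually_lt_const hε).and (eventually_ge_atTop k))
    have hkN : k ≤ N := (hN N le_rfl).2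
    refine (key N ε hε.le (fun j hj => (hN j hj).1.le) (N - k) k hk (by omega) k le_rfl).trans ?_
    gcongr
    exact (Real.prod_one_add_le_exp_sum _ ha).trans
      (Real.exp_le_exp.2 (has.sum_le_tsum _ fun l _ => ha l))
  refine le_of_forall_pos_le_add fun ε hε => ?_
  have := hC (ε / Real.exp (∑' l, a l)) (by positivity)
  rwa [mul_div_cancel₀ _ (Real.exp_pos _).ne', ← zero_add ε] at this

lemma IsRecursiveSystem.unique {q x y₁ y₂ z : ℂ} (hq : ‖q‖ < 1) (hx : ‖x‖ ≤ 1)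
    (hy₁ : ‖y₁‖ ≤ 1) (hy₂ : ‖y₂‖ ≤ 1) (hz : ‖z‖ ≤ 1) {u w u' w' : ℕ → ℂ}
    (h : IsRecursiveSystem q x y₁ y₂ z u w) (h' : IsRecursiveSystem q x y₁ y₂ z u' w')
    {k : ℕ} (hk : 0 < k) : u k = u' k := by
  set d : ℕ → ℝ := fun k => max ‖u k - u' k‖ ‖w k - w' k‖ with hd
  have hu : ∀ k, ‖u k - u' k‖ ≤ d k := fun k => le_max_left _ _
  have hw : ∀ k, ‖w k - w' k‖ ≤ d k := fun k => le_max_right _ _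
  have step_norm : ∀ (s t c : ℂ) (A B : ℝ), ‖s‖ ≤ A → ‖t‖ ≤ B → ∀ C, ‖c‖ ≤ C →
      ‖s + c * t‖ ≤ A + C * B := by
    intro s t c A B hs ht C hc
    refine (norm_add_le _ _).trans (add_le_add hs ?_)
    rw [norm_mul]
    exact mul_le_mul hc ht (norm_nonneg _) ((norm_nonneg _).trans hc)
  have hxy : ∀ y : ℂ, ‖y‖ ≤ 1 → ∀ k, ‖x * y * q ^ k‖ ≤ 2 * ‖q‖ ^ k := by
    intro y hy k
    rw [norm_mul, norm_mul, norm_pow]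
    gcongr
    linarith [mul_le_one₀ hx (norm_nonneg y) hy]
  have hz1 : ∀ k, ‖(1 + z) * x * q ^ k‖ ≤ 2 * ‖q‖ ^ k := by
    intro k
    rw [norm_mul, norm_mul, norm_pow]
    have : ‖1 + z‖ ≤ 2 := (norm_add_le _ _).trans (by rw [norm_one]; linarith)
    gcongr
    exact (mul_le_mul this hx (norm_nonneg _) (by norm_num)).trans (by norm_num)
  have hqk : ∀ k, ‖q‖ ^ k ≤ 1 := fun k => pow_le_one₀ (norm_nonneg _) hq.le
  have hd0 : d k ≤ 0 := by
    refine nonpos_of_forall_le_one_add_mul (a := fun k => 4 * ‖q‖ ^ k) (fun k => by positivity)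
      ((summable_geometric_of_lt_one (norm_nonneg _) hq).mul_left _) ?_ ?_ hk
    · have h1 := (h.tendsto_u.sub h'.tendsto_u).norm
      have h2 := (h.tendsto_w.sub h'.tendsto_w).norm
      simpa using h1.max h2
    · intro k hk B hB hj
      have hwB : ‖w k - w' k‖ ≤ B + ‖q‖ ^ k * B := by
        have hpos : 0 ≤ ‖q‖ ^ k * B := by positivity
        rcases (by omega : k % 2 = 1 ∨ k % 4 = 2 ∨ k % 4 = 0) with hm | hm | hm
        · rw [h.w_odd k hm, h'.w_odd k hm, add_sub_add_comm, ← mul_sub]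
          refine step_norm _ _ _ _ _ ((hu _).trans (hj _ (by omega)))
            ((hw _).trans (hj _ (by omega))) _ ?_
          rw [norm_mul, norm_pow]
          exact (mul_le_of_le_one_left (by positivity) hx).trans
            (pow_le_pow_of_le_one (norm_nonneg _) hq.le (by omega))
        · rw [h.w_two k hm, h'.w_two k hm]
          linarith [hu (k + 4), hj (k + 4) (by omega)]
        · rw [h.w_zero k hk hm, h'.w_zero k hk hm]
          linarith [hu (k + 5), hj (k + 5) (by omega)]
      have hw2 : ‖w k - w' k‖ ≤ 2 * B := by nlinarith [hqk k]
      have huB : ‖u k - u' k‖ ≤ B + 2 * ‖q‖ ^ k * (2 * B) := by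
        have hu1 : ‖u (k + 1) - u' (k + 1)‖ ≤ B := (hu _).trans (hj _ (by omega))
        rcases (by omega : k % 2 = 1 ∨ k % 4 = 2 ∨ k % 4 = 0) with hm | hm | hm
        · rw [h.u_odd k hm, h'.u_odd k hm, add_sub_add_comm, ← mul_sub]
          exact step_norm _ _ _ _ _ hu1 hw2 _ (hz1 k)
        · rw [h.u_two k hm, h'.u_two k hm, add_sub_add_comm, ← mul_sub]
          exact step_norm _ _ _ _ _ hu1 hw2 _ (hxy _ hy₁ k)
        · rw [h.u_zero k hk hm, h'.u_zero k hk hm, add_sub_add_comm, ← mul_sub]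
          exact step_norm _ _ _ _ _ hu1 hw2 _ (hxy _ hy₂ k)
      have hpos : 0 ≤ ‖q‖ ^ k * B := by positivity
      exact max_le (by linarith) (by linarith)
  exact sub_eq_zero.1 (norm_le_zero_iff.1 ((hu k).trans hd0))

lemma qPoch_ne_zero {q : ℂ} (hq : ‖q‖ < 1) (n : ℕ) : qPoch q q n ≠ 0 := by
  refine Finset.prod_ne_zero_iff.2 fun k _ h => ?_
  have h1 : q ^ (k + 1) = 1 := by rw [pow_succ']; exact (sub_eq_zero.1 h).symm
  have h2 := pow_lt_one₀ (norm_nonneg q) hq k.succ_ne_zero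
  rw [← norm_pow, h1, norm_one] at h2
  exact lt_irrefl _ h2

lemma exists_norm_inv_qPoch_le {q : ℂ} (hq : ‖q‖ < 1) :
    ∃ C, 0 ≤ C ∧ ∀ n, ‖(qPoch q q n)⁻¹‖ ≤ C := by
  have hs : Summable fun k : ℕ => ‖-(q * q ^ k)‖ := by
    simp only [norm_neg, norm_mul, norm_pow]
    exact (summable_geometric_of_lt_one (norm_nonneg _) hq).mul_left _
  have hne : ∏' k : ℕ, (1 + -(q * q ^ k)) ≠ 0 := by
    refine tprod_one_add_ne_zero_of_summable (fun k => ?_) hs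
    have := qPoch_ne_zero hq (k + 1)
    rw [qPoch, Finset.prod_range_succ] at this
    simpa [sub_eq_add_neg] using right_ne_zero_of_mul this
  have ht := (multipliable_one_add_of_summable hs).tendsto_prod_tprod_nat.inv₀ hne
  obtain ⟨C, hC⟩ := (Metric.isBounded_range_of_tendsto _ ht).exists_norm_le
  refine ⟨C, (norm_nonneg _).trans (hC _ ⟨0, rfl⟩), fun n => hC _ ⟨n, ?_⟩⟩
  simp [qPoch, sub_eq_add_neg]

/-- The summand of the quadruple series with linear exponent `a n₁ + b n₂ + c n₃ + d n₄`. -/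
noncomputable def quadTerm (q x y₁ y₂ z : ℂ) (a b c d : ℕ) (n : ℕ × ℕ × ℕ × ℕ) : ℂ :=
  x ^ (n.1 + n.2.1 + n.2.2.1 + n.2.2.2) * y₁ ^ n.2.2.1 * y₂ ^ n.2.2.2 * z ^ n.2.1 *
    q ^ (Qform n.1 n.2.1 n.2.2.1 n.2.2.2 + a * n.1 + b * n.2.1 + c * n.2.2.1 + d * n.2.2.2) /
    (qPoch (q ^ 2) (q ^ 2) n.1 * qPoch (q ^ 2) (q ^ 2) n.2.1 *
      qPoch (q ^ 4) (q ^ 4) n.2.2.1 * qPoch (q ^ 4) (q ^ 4) n.2.2.2)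

/-- The quadruple series with linear exponent `a n₁ + b n₂ + c n₃ + d n₄`. -/
noncomputable def quadSum (q x y₁ y₂ z : ℂ) (a b c d : ℕ) : ℂ :=
  ∑' n, quadTerm q x y₁ y₂ z a b c d n

section QuadSum

variable {q x y₁ y₂ z : ℂ}

lemma norm_pow_lt_one_of_pos (hq : ‖q‖ < 1) {m : ℕ} (hm : 0 < m) : ‖q ^ m‖ < 1 := by
  rw [norm_pow]
  exact pow_lt_one₀ (norm_nonneg q) hq hm.ne'

lemma exists_norm_quadTerm_le (hq : ‖q‖ < 1) (hx : ‖x‖ ≤ 1) (hy₁ : ‖y₁‖ ≤ 1) (hy₂ : ‖y₂‖ ≤ 1)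
    (hz : ‖z‖ ≤ 1) :
    ∃ C, 0 ≤ C ∧ ∀ m a b c d, m ≤ a → m ≤ b → m ≤ c → m ≤ d → ∀ n,
      ‖quadTerm q x y₁ y₂ z a b c d n‖ ≤
        C * (‖q‖ ^ m) ^ (n.1 + n.2.1 + n.2.2.1 + n.2.2.2) := by
  obtain ⟨C, hC0, hC⟩ := exists_norm_inv_qPoch_le (norm_pow_lt_one_of_pos hq (m := 2) (by norm_num))
  obtain ⟨D, hD0, hD⟩ := exists_norm_inv_qPoch_le (norm_pow_lt_one_of_pos hq (m := 4) (by norm_num))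
  refine ⟨C * C * D * D, by positivity, fun m a b c d ha hb hc hd n => ?_⟩
  rw [quadTerm, div_eq_mul_inv, mul_comm, norm_mul]
  refine mul_le_mul ?_ ?_ (norm_nonneg _) (by positivity)
  · simp only [mul_inv, norm_mul]
    exact mul_le_mul (mul_le_mul (mul_le_mul (hC _) (hC _) (norm_nonneg _) hC0) (hD _)
      (norm_nonneg _) (by positivity)) (hD _) (norm_nonneg _) (by positivity)
  · simp only [norm_mul, norm_pow]
    rw [← pow_mul]
    have hone : ‖x‖ ^ (n.1 + n.2.1 + n.2.2.1 + n.2.2.2) * ‖y₁‖ ^ n.2.2.1 * ‖y₂‖ ^ n.2.2.2 *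
        ‖z‖ ^ n.2.1 ≤ 1 :=
      mul_le_one₀ (mul_le_one₀ (mul_le_one₀ (pow_le_one₀ (norm_nonneg _) hx) (by positivity)
        (pow_le_one₀ (norm_nonneg _) hy₁)) (by positivity) (pow_le_one₀ (norm_nonneg _) hy₂))
        (by positivity) (pow_le_one₀ (norm_nonneg _) hz)
    refine (mul_le_of_le_one_left (by positivity) hone).trans
      (pow_le_pow_of_le_one (norm_nonneg _) hq.le ?_)
    have := Nat.mul_le_mul_right n.1 ha
    have := Nat.mul_le_mul_right n.2.1 hb
    have := Nat.mul_le_mul_right n.2.2.1 hc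
    have := Nat.mul_le_mul_right n.2.2.2 hd
    simp only [mul_add]
    omega

lemma summable_pow_quadruple {r : ℝ} (hr0 : 0 ≤ r) (hr : r < 1) :
    Summable fun n : ℕ × ℕ × ℕ × ℕ => r ^ (n.1 + n.2.1 + n.2.2.1 + n.2.2.2) := by
  have h := summable_geometric_of_lt_one hr0 hr
  have h0 : 0 ≤ fun n : ℕ => r ^ n := fun n => pow_nonneg hr0 n
  have h2 := h.mul_of_nonneg h h0 h0
  have h3 := h.mul_of_nonneg h2 h0 fun n => mul_nonneg (h0 _) (h0 _)
  have h4 := h.mul_of_nonneg h3 h0 fun n => mul_nonneg (h0 _) (mul_nonneg (h0 _) (h0 _))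
  refine h4.congr fun n => ?_
  simp only [pow_add]
  ring

lemma summable_quadTerm (hq : ‖q‖ < 1) (hx : ‖x‖ ≤ 1) (hy₁ : ‖y₁‖ ≤ 1) (hy₂ : ‖y₂‖ ≤ 1)
    (hz : ‖z‖ ≤ 1) {a b c d : ℕ} (ha : 0 < a) (hb : 0 < b) (hc : 0 < c) (hd : 0 < d) :
    Summable (quadTerm q x y₁ y₂ z a b c d) := by
  obtain ⟨C, -, hC⟩ := exists_norm_quadTerm_le hq hx hy₁ hy₂ hz
  refine Summable.of_norm_bounded ((summable_pow_quadruple (norm_nonneg q) hq).mul_left C)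
    fun n => ?_
  simpa using hC 1 a b c d ha hb hc hd n

lemma tendsto_quadSum (hq : ‖q‖ < 1) (hx : ‖x‖ ≤ 1) (hy₁ : ‖y₁‖ ≤ 1) (hy₂ : ‖y₂‖ ≤ 1)
    (hz : ‖z‖ ≤ 1) {a b c d : ℕ → ℕ} (ha : ∀ k, k ≤ a k) (hb : ∀ k, k ≤ b k)
    (hc : ∀ k, k ≤ c k) (hd : ∀ k, k ≤ d k) :
    Tendsto (fun k => quadSum q x y₁ y₂ z (a k) (b k) (c k) (d k)) atTop (𝓝 1) := by
  obtain ⟨C, hC0, hC⟩ := exists_norm_quadTerm_le hq hx hy₁ hy₂ hz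
  have h1 : ∑' n : ℕ × ℕ × ℕ × ℕ, (if n = 0 then (1 : ℂ) else 0) = 1 := tsum_ite_eq _ _
  rw [← h1]
  refine tendsto_tsum_of_dominated_convergence
    ((summable_pow_quadruple (norm_nonneg q) hq).mul_left C) (fun n => ?_) ?_
  · split_ifs with hn
    · subst hn
      simp [quadTerm, Qform, qPoch]
    · have hn' : n.1 + n.2.1 + n.2.2.1 + n.2.2.2 ≠ 0 := by
        rintro h
        apply hn
        obtain ⟨n₁, n₂, n₃, n₄⟩ := n
        simp only [Prod.mk_eq_zero]
        simp only at h
        omega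
      refine squeeze_zero_norm (fun k => hC k _ _ _ _ (ha k) (hb k) (hc k) (hd k) n) ?_
      have := ((tendsto_pow_atTop_nhds_zero_of_lt_one (norm_nonneg q) hq).pow
        (n.1 + n.2.1 + n.2.2.1 + n.2.2.2)).const_mul C
      simpa only [zero_pow hn', mul_zero] using this
  · filter_upwards [eventually_ge_atTop 1] with k hk n
    simpa using hC 1 _ _ _ _ (hk.trans (ha k)) (hk.trans (hb k)) (hk.trans (hc k))
      (hk.trans (hd k)) n

lemma choose_succ_two (n : ℕ) : (n + 1).choose 2 = n + n.choose 2 := by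
  simp [Nat.choose_succ_succ' n 1]

lemma qPoch_succ (q : ℂ) (n : ℕ) : qPoch q q (n + 1) = qPoch q q n * (1 - q ^ (n + 1)) := by
  rw [qPoch, Finset.prod_range_succ, ← pow_succ', qPoch]

lemma one_sub_pow_succ_ne_zero (hq : ‖q‖ < 1) (n : ℕ) : 1 - q ^ (n + 1) ≠ 0 := by
  have := qPoch_ne_zero hq (n + 1)
  rw [qPoch_succ] at this
  exact right_ne_zero_of_mul this

/-- If the difference of two families vanishes off the range of an injection `g`, and is a multiple
of a third family along `g`, then so are the sums. -/
lemma tsum_eq_add_mul_tsum {ι : Type*} {f f' h : ι → ℂ} {g : ι → ι} (hg : g.Injective) (s : ℂ)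
    (hf : Summable f) (hf' : Summable f') (hrange : ∀ n, n ∉ Set.range g → f n = f' n)
    (hstep : ∀ n, f (g n) - f' (g n) = s * h n) :
    ∑' n, f n = ∑' n, f' n + s * ∑' n, h n := by
  have hsupp : Function.support (fun n => f n - f' n) ⊆ Set.range g := by
    intro n hn
    by_contra h
    exact hn (sub_eq_zero.2 (hrange n h))
  rw [← tsum_mul_left, ← tsum_congr hstep, hg.tsum_eq hsupp, hf.tsum_sub hf']
  ring

variable {a b c d : ℕ}

lemma quadSum_shift_first (hq : ‖q‖ < 1) (hx : ‖x‖ ≤ 1) (hy₁ : ‖y₁‖ ≤ 1)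
    (hy₂ : ‖y₂‖ ≤ 1) (hz : ‖z‖ ≤ 1)
    (ha : 0 < a) (hb : 0 < b) (hc : 0 < c) (hd : 0 < d) :
    quadSum q x y₁ y₂ z a b c d = quadSum q x y₁ y₂ z (a + 2) b c d +
      x * q ^ a * quadSum q x y₁ y₂ z (a + 4) (b + 4) (c + 4) (d + 4) := by
  refine tsum_eq_add_mul_tsum (g := fun n => (n.1 + 1, n.2)) (fun n m h => by aesop) _
    (summable_quadTerm hq hx hy₁ hy₂ hz ha hb hc hd)
    (summable_quadTerm hq hx hy₁ hy₂ hz (by omega) hb hc hd) ?_ ?_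
  · rintro ⟨_ | n₁, n₂, n₃, n₄⟩ hn
    · simp [quadTerm]
    · exact absurd ⟨(n₁, n₂, n₃, n₄), rfl⟩ hn
  · rintro ⟨n₁, n₂, n₃, n₄⟩
    have h2 := norm_pow_lt_one_of_pos hq (m := 2) (by norm_num)
    have h4 := norm_pow_lt_one_of_pos hq (m := 4) (by norm_num)
    have := qPoch_ne_zero h2 n₁
    have := qPoch_ne_zero h2 n₂
    have := qPoch_ne_zero h4 n₃
    have := qPoch_ne_zero h4 n₄
    have := one_sub_pow_succ_ne_zero h2 n₁
    simp only [quadTerm, Qform, choose_succ_two, qPoch_succ]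
    rw [← sub_div, div_eq_iff (by positivity), ← mul_div_assoc, div_mul_eq_mul_div,
      eq_div_iff (by positivity)]
    ring

lemma quadSum_shift_second (hq : ‖q‖ < 1) (hx : ‖x‖ ≤ 1) (hy₁ : ‖y₁‖ ≤ 1)
    (hy₂ : ‖y₂‖ ≤ 1) (hz : ‖z‖ ≤ 1)
    (ha : 0 < a) (hb : 0 < b) (hc : 0 < c) (hd : 0 < d) :
    quadSum q x y₁ y₂ z a b c d = quadSum q x y₁ y₂ z a (b + 2) c d +
      x * z * q ^ b * quadSum q x y₁ y₂ z (a + 4) (b + 6) (c + 4) (d + 4) := by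
  refine tsum_eq_add_mul_tsum (g := fun n => (n.1, n.2.1 + 1, n.2.2)) (fun n m h => by aesop) _
    (summable_quadTerm hq hx hy₁ hy₂ hz ha hb hc hd)
    (summable_quadTerm hq hx hy₁ hy₂ hz ha (by omega) hc hd) ?_ ?_
  · rintro ⟨n₁, _ | n₂, n₃, n₄⟩ hn
    · simp [quadTerm]
    · exact absurd ⟨(n₁, n₂, n₃, n₄), rfl⟩ hn
  · rintro ⟨n₁, n₂, n₃, n₄⟩
    have h2 := norm_pow_lt_one_of_pos hq (m := 2) (by norm_num)
    have h4 := norm_pow_lt_one_of_pos hq (m := 4) (by norm_num)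
    have := qPoch_ne_zero h2 n₁
    have := qPoch_ne_zero h2 n₂
    have := qPoch_ne_zero h4 n₃
    have := qPoch_ne_zero h4 n₄
    have := one_sub_pow_succ_ne_zero h2 n₂
    simp only [quadTerm, Qform, choose_succ_two, qPoch_succ]
    rw [← sub_div, div_eq_iff (by positivity), ← mul_div_assoc, div_mul_eq_mul_div,
      eq_div_iff (by positivity)]
    ring

lemma quadSum_shift_third (hq : ‖q‖ < 1) (hx : ‖x‖ ≤ 1) (hy₁ : ‖y₁‖ ≤ 1)
    (hy₂ : ‖y₂‖ ≤ 1) (hz : ‖z‖ ≤ 1)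
    (ha : 0 < a) (hb : 0 < b) (hc : 0 < c) (hd : 0 < d) :
    quadSum q x y₁ y₂ z a b c d = quadSum q x y₁ y₂ z a b (c + 4) d +
      x * y₁ * q ^ c * quadSum q x y₁ y₂ z (a + 4) (b + 4) (c + 4) (d + 4) := by
  refine tsum_eq_add_mul_tsum (g := fun n => (n.1, n.2.1, n.2.2.1 + 1, n.2.2.2))
    (fun n m h => by aesop) _ (summable_quadTerm hq hx hy₁ hy₂ hz ha hb hc hd)
    (summable_quadTerm hq hx hy₁ hy₂ hz ha hb (by omega) hd) ?_ ?_
  · rintro ⟨n₁, n₂, _ | n₃, n₄⟩ hn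
    · simp [quadTerm]
    · exact absurd ⟨(n₁, n₂, n₃, n₄), rfl⟩ hn
  · rintro ⟨n₁, n₂, n₃, n₄⟩
    have h2 := norm_pow_lt_one_of_pos hq (m := 2) (by norm_num)
    have h4 := norm_pow_lt_one_of_pos hq (m := 4) (by norm_num)
    have := qPoch_ne_zero h2 n₁
    have := qPoch_ne_zero h2 n₂
    have := qPoch_ne_zero h4 n₃
    have := qPoch_ne_zero h4 n₄
    have := one_sub_pow_succ_ne_zero h4 n₃
    simp only [quadTerm, Qform, choose_succ_two, qPoch_succ]
    rw [← sub_div, div_eq_iff (by positivity), ← mul_div_assoc, div_mul_eq_mul_div,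
      eq_div_iff (by positivity)]
    ring

lemma quadSum_shift_fourth (hq : ‖q‖ < 1) (hx : ‖x‖ ≤ 1) (hy₁ : ‖y₁‖ ≤ 1)
    (hy₂ : ‖y₂‖ ≤ 1) (hz : ‖z‖ ≤ 1)
    (ha : 0 < a) (hb : 0 < b) (hc : 0 < c) (hd : 0 < d) :
    quadSum q x y₁ y₂ z a b c d = quadSum q x y₁ y₂ z a b c (d + 4) +
      x * y₂ * q ^ d * quadSum q x y₁ y₂ z (a + 4) (b + 4) (c + 4) (d + 8) := by
  refine tsum_eq_add_mul_tsum (g := fun n => (n.1, n.2.1, n.2.2.1, n.2.2.2 + 1))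
    (fun n m h => by aesop) _ (summable_quadTerm hq hx hy₁ hy₂ hz ha hb hc hd)
    (summable_quadTerm hq hx hy₁ hy₂ hz ha hb hc (by omega)) ?_ ?_
  · rintro ⟨n₁, n₂, n₃, _ | n₄⟩ hn
    · simp [quadTerm]
    · exact absurd ⟨(n₁, n₂, n₃, n₄), rfl⟩ hn
  · rintro ⟨n₁, n₂, n₃, n₄⟩
    have h2 := norm_pow_lt_one_of_pos hq (m := 2) (by norm_num)
    have h4 := norm_pow_lt_one_of_pos hq (m := 4) (by norm_num)
    have := qPoch_ne_zero h2 n₁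
    have := qPoch_ne_zero h2 n₂
    have := qPoch_ne_zero h4 n₃
    have := qPoch_ne_zero h4 n₄
    have := one_sub_pow_succ_ne_zero h4 n₄
    simp only [quadTerm, Qform, choose_succ_two, qPoch_succ]
    rw [← sub_div, div_eq_iff (by positivity), ← mul_div_assoc, div_mul_eq_mul_div,
      eq_div_iff (by positivity)]
    ring

end QuadSum

/-- The series for the members of `𝒜` with all parts at least `k`. -/
noncomputable def quadU (q x y₁ y₂ z : ℂ) (k : ℕ) : ℂ :=
  quadSum q x y₁ y₂ z (2 * (k / 2) + 1) (2 * (k / 2) + 1) (4 * ((k + 1) / 4) + 2)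
    (4 * ((k + 3) / 4))

/-- The series for the members of `𝒜` that may follow a smallest part `k`. -/
noncomputable def quadW (q x y₁ y₂ z : ℂ) (k : ℕ) : ℂ :=
  if k % 2 = 1 then
    quadSum q x y₁ y₂ z (k + 4) (k + 6) (4 * ((k + 1) / 4) + 6) (4 * ((k + 3) / 4) + 4)
  else if k % 4 = 2 then quadU q x y₁ y₂ z (k + 4) else quadU q x y₁ y₂ z (k + 5)

lemma isRecursiveSystem_quad {q x y₁ y₂ z : ℂ} (hq : ‖q‖ < 1) (hx : ‖x‖ ≤ 1)
    (hy₁ : ‖y₁‖ ≤ 1) (hy₂ : ‖y₂‖ ≤ 1) (hz : ‖z‖ ≤ 1) :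
    IsRecursiveSystem q x y₁ y₂ z (quadU q x y₁ y₂ z) (quadW q x y₁ y₂ z) := by
  have hU : ∀ k a c d, 2 * (k / 2) + 1 = a → 4 * ((k + 1) / 4) + 2 = c → 4 * ((k + 3) / 4) = d →
      quadU q x y₁ y₂ z k = quadSum q x y₁ y₂ z a a c d := by
    rintro k _ _ _ rfl rfl rfl
    rfl
  have hW : ∀ k b c d, k % 2 = 1 → k + 6 = b → 4 * ((k + 1) / 4) + 6 = c →
      4 * ((k + 3) / 4) + 4 = d →
      quadW q x y₁ y₂ z k = quadSum q x y₁ y₂ z (k + 4) b c d := by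
    rintro k _ _ _ hk rfl rfl rfl
    rw [quadW, if_pos hk]
  have htU : Tendsto (quadU q x y₁ y₂ z) atTop (𝓝 1) :=
    tendsto_quadSum hq hx hy₁ hy₂ hz (fun k => by omega) (fun k => by omega) (fun k => by omega)
      (fun k => by omega)
  refine ⟨fun k hk => ?_, fun k hk => ?_, fun k hk0 hk => ?_, fun k hk => ?_, fun k hk => ?_,
    fun k _ hk => ?_, htU, ?_⟩
  · rw [hU k k _ _ (by omega) rfl rfl, quadSum_shift_second hq hx hy₁ hy₂ hz (by omega) (by omega)
      (by omega) (by omega), quadSum_shift_first hq hx hy₁ hy₂ hz (by omega) (by omega)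
      (by omega) (by omega), hW k _ _ _ hk rfl rfl rfl, hU (k + 1) (k + 2)
      (4 * ((k + 1) / 4) + 2) (4 * ((k + 3) / 4)) (by omega) (by omega) (by omega)]
    ring
  · rw [hU k (k + 1) k (k + 2) (by omega) (by omega) (by omega),
      quadSum_shift_third hq hx hy₁ hy₂ hz (by omega) (by omega) (by omega) (by omega),
      quadW, if_neg (by omega), if_pos hk, hU (k + 1) (k + 1) (k + 4) (k + 2) (by omega)
      (by omega) (by omega), hU (k + 4) (k + 5) (k + 4) (k + 6) (by omega) (by omega) (by omega)]
  · rw [hU k (k + 1) (k + 2) k (by omega) (by omega) (by omega),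
      quadSum_shift_fourth hq hx hy₁ hy₂ hz (by omega) (by omega) (by omega) (by omega),
      quadW, if_neg (by omega), if_neg (by omega), hU (k + 1) (k + 1) (k + 2) (k + 4) (by omega)
      (by omega) (by omega), hU (k + 5) (k + 5) (k + 6) (k + 8) (by omega) (by omega) (by omega)]
  · rw [hW k (k + 6) _ _ hk rfl rfl rfl, quadSum_shift_first hq hx hy₁ hy₂ hz (by omega) (by omega)
      (by omega) (by omega), hW (k + 4) (k + 10) (4 * ((k + 1) / 4) + 10)
      (4 * ((k + 3) / 4) + 8) (by omega) (by omega) (by omega) (by omega),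
      hU (k + 5) (k + 6) (4 * ((k + 1) / 4) + 6) (4 * ((k + 3) / 4) + 4) (by omega) (by omega)
      (by omega)]
  · rw [quadW, if_neg (by omega), if_pos hk]
  · rw [quadW, if_neg (by omega), if_neg (by omega)]
  · refine Tendsto.if' ?_ (Tendsto.if' ?_ ?_)
    · exact tendsto_quadSum hq hx hy₁ hy₂ hz (fun k => by omega) (fun k => by omega)
        (fun k => by omega) (fun k => by omega)
    · exact htU.comp (tendsto_add_atTop_nat 4)
    · exact htU.comp (tendsto_add_atTop_nat 5)

/-- The weight of a pair `(P, O)` in the generating function of `𝒜`. -/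
@[irreducible]
noncomputable def weight (q x y₁ y₂ z : ℂ) (l : Finset ℕ × Finset ℕ) : ℂ :=
  x ^ l.1.card * y₁ ^ countMod 2 4 l.1 * y₂ ^ countMod 0 4 l.1 * z ^ l.2.card * q ^ l.1.sum id

/-- The members of `𝒜` with all parts at least `k`. -/
def setU (k : ℕ) : Set (Finset ℕ × Finset ℕ) := {l | MemA l.1 l.2 ∧ ∀ p ∈ l.1, k ≤ p}

/-- The members of `𝒜` to which a part `k` may be added as the smallest part. -/
def setW (k : ℕ) : Set (Finset ℕ × Finset ℕ) :=
  {l | MemA l.1 l.2 ∧ ∀ p ∈ l.1, k + 4 ≤ p ∧ ((p ∈ l.2 ∨ 4 ∣ p) → k + 5 ≤ p)}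

/-- Add a part. -/
def addPart (k : ℕ) (l : Finset ℕ × Finset ℕ) : Finset ℕ × Finset ℕ := (insert k l.1, l.2)

/-- Add an overlined part. -/
def addOverlined (k : ℕ) (l : Finset ℕ × Finset ℕ) : Finset ℕ × Finset ℕ :=
  (insert k l.1, insert k l.2)

lemma MemA.subset {P O : Finset ℕ} (h : MemA P O) : O ⊆ P := h.2.1

lemma setW_subset_setU (k : ℕ) : setW k ⊆ setU (k + 4) := fun _ h =>
  ⟨h.1, fun p hp => (h.2 p hp).1⟩

lemma setU_subset (k : ℕ) : setU k ⊆ {l | MemA l.1 l.2} := fun _ h => h.1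

lemma notMem_of_mem_setW {k : ℕ} {l : Finset ℕ × Finset ℕ} (h : l ∈ setW k) : k ∉ l.1 :=
  fun hk => by have := (h.2 k hk).1; omega

lemma notMem_snd_of_mem_setW {k : ℕ} {l : Finset ℕ × Finset ℕ} (h : l ∈ setW k) : k ∉ l.2 :=
  fun hk => notMem_of_mem_setW h (h.1.subset hk)

lemma addPart_injOn (k : ℕ) : Set.InjOn (addPart k) (setW k) := by
  intro l hl m hm h
  simp only [addPart, Prod.mk.injEq] at h
  refine Prod.ext ?_ h.2
  rw [← Finset.erase_insert (notMem_of_mem_setW hl), h.1,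
    Finset.erase_insert (notMem_of_mem_setW hm)]

lemma addOverlined_injOn (k : ℕ) : Set.InjOn (addOverlined k) (setW k) := by
  intro l hl m hm h
  simp only [addOverlined, Prod.mk.injEq] at h
  refine Prod.ext ?_ ?_
  · rw [← Finset.erase_insert (notMem_of_mem_setW hl), h.1,
      Finset.erase_insert (notMem_of_mem_setW hm)]
  · rw [← Finset.erase_insert (notMem_snd_of_mem_setW hl), h.2,
      Finset.erase_insert (notMem_snd_of_mem_setW hm)]

lemma addPart_image_setW {k : ℕ} (hk : 0 < k) :
    addPart k '' setW k = {l | l ∈ setU k ∧ k ∈ l.1 ∧ k ∉ l.2} := by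
  ext ⟨P, O⟩
  constructor
  · rintro ⟨⟨P', O'⟩, hl, h⟩
    have hn := notMem_snd_of_mem_setW hl
    obtain ⟨⟨h0, h1, h2, h3⟩, h4⟩ := hl
    simp only [addPart, Prod.mk.injEq] at h hn h0 h1 h2 h3 h4
    obtain ⟨rfl, rfl⟩ := h
    refine ⟨⟨⟨?_, ?_, ?_, ?_⟩, ?_⟩, by simp, hn⟩ <;> simp only [Finset.mem_insert]
    · grind
    · grind
    · grind
    · rintro a (rfl | ha) b (rfl | hb) hab
      · omega
      · have := (h4 b hb).1
        omega
      · have := h4 a ha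
        grind
      · exact h3 a ha b hb hab
    · rintro p (rfl | hp)
      · rfl
      · have := (h4 p hp).1
        omega
  · rintro ⟨⟨⟨h0, h1, h2, h3⟩, h4⟩, hkP, hkO⟩
    simp only at h0 h1 h2 h3 h4 hkP hkO
    refine ⟨(P.erase k, O), ⟨⟨?_, ?_, h2, ?_⟩, ?_⟩, ?_⟩
    · grind
    · exact Finset.subset_erase.2 ⟨h1, hkO⟩
    · intro a ha b hb
      exact h3 a (Finset.mem_of_mem_erase ha) b (Finset.mem_of_mem_erase hb)
    · intro p hp
      simp only [Finset.mem_erase] at hp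
      have hkp := lt_of_le_of_ne (h4 p hp.2) (Ne.symm hp.1)
      have := h3 p hp.2 k hkP hkp
      grind
    · simp [addPart, Finset.insert_erase hkP]

lemma addOverlined_image_setW {k : ℕ} (hk : k % 2 = 1) :
    addOverlined k '' setW k = {l | l ∈ setU k ∧ k ∈ l.2} := by
  ext ⟨P, O⟩
  constructor
  · rintro ⟨⟨P', O'⟩, hl, h⟩
    have hn := notMem_of_mem_setW hl
    obtain ⟨⟨h0, h1, h2, h3⟩, h4⟩ := hl
    simp only [addOverlined, Prod.mk.injEq] at h hn h0 h1 h2 h3 h4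
    obtain ⟨rfl, rfl⟩ := h
    refine ⟨⟨⟨?_, ?_, ?_, ?_⟩, ?_⟩, by simp⟩ <;> simp only [Finset.mem_insert]
    · grind
    · exact Finset.insert_subset_insert _ h1
    · rintro p (rfl | hp)
      · exact Nat.odd_iff.2 hk
      · exact h2 p hp
    · rintro a (rfl | ha) b (rfl | hb) hab
      · omega
      · have := (h4 b hb).1
        omega
      · have := h4 a ha
        grind
      · have := h3 a ha b hb hab
        grind
    · rintro p (rfl | hp)
      · rfl
      · have := (h4 p hp).1
        omega
  · rintro ⟨⟨⟨h0, h1, h2, h3⟩, h4⟩, hkO⟩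
    simp only at h0 h1 h2 h3 h4 hkO
    have hkP := h1 hkO
    refine ⟨(P.erase k, O.erase k), ⟨⟨?_, ?_, ?_, ?_⟩, ?_⟩, ?_⟩
    · grind
    · exact Finset.erase_subset_erase _ h1
    · exact fun p hp => h2 p (Finset.mem_of_mem_erase hp)
    · intro a ha b hb hab
      have := h3 a (Finset.mem_of_mem_erase ha) b (Finset.mem_of_mem_erase hb) hab
      grind
    · intro p hp
      simp only [Finset.mem_erase] at hp ⊢
      have hkp := lt_of_le_of_ne (h4 p hp.2) (Ne.symm hp.1)
      have := h3 p hp.2 k hkP hkp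
      grind
    · simp [addOverlined, Finset.insert_erase hkP, Finset.insert_erase hkO]

lemma setU_eq_union (k : ℕ) :
    setU k = setU (k + 1) ∪ ({l | l ∈ setU k ∧ k ∈ l.1 ∧ k ∉ l.2} ∪ {l | l ∈ setU k ∧ k ∈ l.2}) := by
  ext l
  simp only [setU, Set.mem_union, Set.mem_ofPred_eq]
  constructor
  · rintro ⟨h, hl⟩
    by_cases hk : k ∈ l.1
    · tauto
    · refine Or.inl ⟨h, fun p hp => lt_of_le_of_ne (hl p hp) ?_⟩
      rintro rfl
      exact hk hp
  · rintro (⟨h, hl⟩ | h | h)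
    · exact ⟨h, fun p hp => (Nat.le_succ k).trans (hl p hp)⟩
    · exact h.1
    · exact h.1

lemma notMem_setU_succ {k : ℕ} {l : Finset ℕ × Finset ℕ} (h : k ∈ l.1) : l ∉ setU (k + 1) :=
  fun hl => by have := hl.2 k h; omega

lemma setW_eq_union {k : ℕ} (hk : k % 2 = 1) :
    setW k = setU (k + 5) ∪ {l | l ∈ setU (k + 4) ∧ k + 4 ∈ l.1 ∧ k + 4 ∉ l.2} := by
  ext l
  simp only [setU, setW, Set.mem_union, Set.mem_ofPred_eq]
  constructor
  · rintro ⟨h, hl⟩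
    by_cases h4 : k + 4 ∈ l.1
    · refine Or.inr ⟨⟨h, fun p hp => (hl p hp).1⟩, h4, fun hO => ?_⟩
      have := (hl _ h4).2 (Or.inl hO)
      omega
    · refine Or.inl ⟨h, fun p hp => lt_of_le_of_ne (hl p hp).1 ?_⟩
      rintro rfl
      exact h4 hp
  · rintro (⟨h, hl⟩ | ⟨⟨h, hl⟩, h4, hO⟩)
    · exact ⟨h, fun p hp => ⟨(Nat.le_succ _).trans (hl p hp), fun _ => hl p hp⟩⟩
    · refine ⟨h, fun p hp => ⟨hl p hp, fun hp' => lt_of_le_of_ne (hl p hp) ?_⟩⟩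
      rintro rfl
      rcases hp' with hp' | hp'
      · exact hO hp'
      · omega

lemma setW_of_mod_four_eq_two {k : ℕ} (hk : k % 4 = 2) : setW k = setU (k + 4) := by
  refine (setW_subset_setU k).antisymm fun l hl => ⟨hl.1, fun p hp => ⟨hl.2 p hp, fun hp' => ?_⟩⟩
  have h4 := hl.2 p hp
  have : p % 2 = 1 ∨ p % 4 = 0 := hp'.imp (fun h => Nat.odd_iff.1 (hl.1.2.2.1 p h)) (by omega)
  omega

lemma setW_of_mod_four_eq_zero {k : ℕ} (hk : k % 4 = 0) : setW k = setU (k + 5) := by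
  ext l
  refine ⟨fun hl => ⟨hl.1, fun p hp => ?_⟩, fun hl => ⟨hl.1, fun p hp =>
    ⟨(Nat.le_succ _).trans (hl.2 p hp), fun _ => hl.2 p hp⟩⟩⟩
  have := hl.2 p hp
  omega

lemma overlined_eq_empty {k : ℕ} (hk : k % 2 = 0) : {l | l ∈ setU k ∧ k ∈ l.2} = ∅ := by
  refine Set.eq_empty_of_forall_notMem fun l hl => ?_
  have := Nat.odd_iff.1 (hl.1.1.2.2.1 k hl.2)
  omega

lemma setU_two : setU 2 = {l | MemA l.1 l.2 ∧ 1 ∉ l.1} := by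
  ext l
  refine and_congr_right fun h => ⟨fun hl h1 => by have := hl 1 h1; omega, fun h1 p hp => ?_⟩
  have := h.1 p hp
  have : p ≠ 1 := fun h => h1 (h ▸ hp)
  omega

lemma countMod_insert {k : ℕ} {P : Finset ℕ} (hk : k ∉ P) (a M : ℕ) :
    countMod a M (insert k P) = countMod a M P + if k % M = a then 1 else 0 := by
  rw [countMod, countMod, Finset.filter_insert]
  split_ifs with h
  · rw [Finset.card_insert_of_notMem (by simp [hk])]
  · rfl

section GeneratingFunction

variable {q x y₁ y₂ z : ℂ}

lemma weight_addPart {k : ℕ} {l : Finset ℕ × Finset ℕ} (h : l ∈ setW k) :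
    weight q x y₁ y₂ z (addPart k l) =
      x * y₁ ^ (if k % 4 = 2 then 1 else 0) * y₂ ^ (if k % 4 = 0 then 1 else 0) * q ^ k *
        weight q x y₁ y₂ z l := by
  have hk := notMem_of_mem_setW h
  simp only [weight, addPart, countMod_insert hk, Finset.card_insert_of_notMem hk,
    Finset.sum_insert hk, id]
  ring

lemma weight_addOverlined {k : ℕ} (hk2 : k % 2 = 1) {l : Finset ℕ × Finset ℕ} (h : l ∈ setW k) :
    weight q x y₁ y₂ z (addOverlined k l) = z * x * q ^ k * weight q x y₁ y₂ z l := by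
  have hk := notMem_of_mem_setW h
  simp only [weight, addOverlined, countMod_insert hk, Finset.card_insert_of_notMem hk,
    Finset.card_insert_of_notMem (notMem_snd_of_mem_setW h), Finset.sum_insert hk, id]
  rw [if_neg (by omega), if_neg (by omega)]
  ring

lemma summable_norm_weight (hq : ‖q‖ < 1) (hx : ‖x‖ ≤ 1) (hy₁ : ‖y₁‖ ≤ 1)
    (hy₂ : ‖y₂‖ ≤ 1) (hz : ‖z‖ ≤ 1) :
    Summable fun l : {l : Finset ℕ × Finset ℕ | MemA l.1 l.2} => ‖weight q x y₁ y₂ z l‖ := by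
  have hs := summable_finsetProd_of_summable_nonneg (fun i => pow_nonneg (norm_nonneg q) i)
    (summable_geometric_of_lt_one (norm_nonneg q) hq)
  have hs2 := hs.mul_of_nonneg hs (fun s => Finset.prod_nonneg fun i _ => by positivity)
    (fun s => Finset.prod_nonneg fun i _ => by positivity)
  have hinj : Function.Injective fun l : {l : Finset ℕ × Finset ℕ | MemA l.1 l.2} =>
      (l.1.1 \ l.1.2, l.1.2) := by
    rintro ⟨⟨P, O⟩, hl⟩ ⟨⟨P', O'⟩, hm⟩ h
    simp only [Prod.mk.injEq] at h
    obtain ⟨h, rfl⟩ := h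
    have := congrArg (· ∪ O) h
    simp only [Finset.sdiff_union_of_subset hl.subset, Finset.sdiff_union_of_subset hm.subset]
      at this
    subst this
    rfl
  refine (hs2.comp_injective hinj).of_nonneg_of_le (fun _ => norm_nonneg _) fun l => ?_
  have hprod : (∏ i ∈ l.1.1 \ l.1.2, ‖q‖ ^ i) * ∏ i ∈ l.1.2, ‖q‖ ^ i = ‖q‖ ^ l.1.1.sum id := by
    rw [Finset.prod_sdiff (MemA.subset l.2), Finset.prod_pow_eq_pow_sum]
    rfl
  simp only [Function.comp_apply, weight, norm_mul, norm_pow]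
  rw [hprod]
  refine mul_le_of_le_one_left (by positivity) ?_
  exact mul_le_one₀ (mul_le_one₀ (mul_le_one₀ (pow_le_one₀ (norm_nonneg _) hx) (by positivity)
    (pow_le_one₀ (norm_nonneg _) hy₁)) (by positivity) (pow_le_one₀ (norm_nonneg _) hy₂))
    (by positivity) (pow_le_one₀ (norm_nonneg _) hz)

lemma summable_weight (hq : ‖q‖ < 1) (hx : ‖x‖ ≤ 1) (hy₁ : ‖y₁‖ ≤ 1)
    (hy₂ : ‖y₂‖ ≤ 1) (hz : ‖z‖ ≤ 1)
    {s : Set (Finset ℕ × Finset ℕ)} (hs : s ⊆ {l | MemA l.1 l.2}) :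
    Summable fun l : s => weight q x y₁ y₂ z l :=
  have h : Summable fun l : {l : Finset ℕ × Finset ℕ | MemA l.1 l.2} => weight q x y₁ y₂ z l :=
    (summable_norm_weight hq hx hy₁ hy₂ hz).of_norm
  h.comp_injective (Set.inclusion_injective hs)

lemma tendsto_tsum_weight (hq : ‖q‖ < 1) (hx : ‖x‖ ≤ 1) (hy₁ : ‖y₁‖ ≤ 1)
    (hy₂ : ‖y₂‖ ≤ 1) (hz : ‖z‖ ≤ 1)
    {s : ℕ → Set (Finset ℕ × Finset ℕ)} (hs : ∀ k, s k ⊆ setU k)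
    (hs0 : ∀ k, (∅, ∅) ∈ s k) :
    Tendsto (fun k => ∑' l : s k, weight q x y₁ y₂ z l) atTop (𝓝 1) := by
  have h1 : ∑' l : Finset ℕ × Finset ℕ, (if l = (∅, ∅) then (1 : ℂ) else 0) = 1 := tsum_ite_eq _ _
  rw [← h1]
  simp only [tsum_subtype]
  have hbound : Summable ({l : Finset ℕ × Finset ℕ | MemA l.1 l.2}.indicator
      fun l => ‖weight q x y₁ y₂ z l‖) :=
    summable_subtype_iff_indicator.1 (summable_norm_weight hq hx hy₁ hy₂ hz)
  refine tendsto_tsum_of_dominated_convergence hbound (fun l => ?_) ?_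
  · refine tendsto_const_nhds.congr' ?_
    split_ifs with hl
    · subst hl
      refine Eventually.of_forall fun k => ?_
      simp [Set.indicator_of_mem (hs0 k), weight, countMod]
    · filter_upwards [eventually_gt_atTop (l.1.sum id)] with k hk
      refine (Set.indicator_of_notMem (fun hmem => hl ?_) _).symm
      obtain ⟨hA, hle⟩ := hs k hmem
      have hP : l.1 = ∅ := by
        refine Finset.eq_empty_of_forall_notMem fun p hp => ?_
        have h1 := hle p hp
        have h2 : p ≤ l.1.sum id := Finset.single_le_sum (f := id) (fun _ _ => Nat.zero_le _) hp
        omega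
      exact Prod.ext hP (Finset.subset_empty.1 (hP ▸ hA.subset))
  · refine Eventually.of_forall fun k l => ?_
    rw [norm_indicator_eq_indicator_norm]
    exact Set.indicator_le_indicator_of_subset ((hs k).trans (setU_subset k))
      (fun _ => norm_nonneg _) l

lemma tsum_setU (hq : ‖q‖ < 1) (hx : ‖x‖ ≤ 1) (hy₁ : ‖y₁‖ ≤ 1)
    (hy₂ : ‖y₂‖ ≤ 1) (hz : ‖z‖ ≤ 1)
    (k : ℕ) :
    ∑' l : setU k, weight q x y₁ y₂ z l = ∑' l : setU (k + 1), weight q x y₁ y₂ z l +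
      (∑' l : {l | l ∈ setU k ∧ k ∈ l.1 ∧ k ∉ l.2}, weight q x y₁ y₂ z l +
        ∑' l : {l | l ∈ setU k ∧ k ∈ l.2}, weight q x y₁ y₂ z l) := by
  have hA : {l | l ∈ setU k ∧ k ∈ l.1 ∧ k ∉ l.2} ⊆ {l | MemA l.1 l.2} := fun l hl => hl.1.1
  have hB : {l | l ∈ setU k ∧ k ∈ l.2} ⊆ {l | MemA l.1 l.2} := fun l hl => hl.1.1
  conv_lhs => rw [setU_eq_union k]
  rw [Summable.tsum_union_disjoint _ (summable_weight hq hx hy₁ hy₂ hz (setU_subset _))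
    (summable_weight hq hx hy₁ hy₂ hz (Set.union_subset hA hB)),
    Summable.tsum_union_disjoint _ (summable_weight hq hx hy₁ hy₂ hz hA)
    (summable_weight hq hx hy₁ hy₂ hz hB)]
  · exact Set.disjoint_left.2 fun l hl hl' => hl.2.2 hl'.2
  · refine Set.disjoint_right.2 ?_
    rintro l (hl | hl)
    · exact notMem_setU_succ hl.2.1
    · exact notMem_setU_succ (hl.1.1.subset hl.2)

lemma tsum_addPart {k : ℕ} (hk : 0 < k) :
    ∑' l : {l | l ∈ setU k ∧ k ∈ l.1 ∧ k ∉ l.2}, weight q x y₁ y₂ z l =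
      x * y₁ ^ (if k % 4 = 2 then 1 else 0) * y₂ ^ (if k % 4 = 0 then 1 else 0) * q ^ k *
        ∑' l : setW k, weight q x y₁ y₂ z l := by
  rw [← addPart_image_setW hk, tsum_image _ (addPart_injOn k), ← tsum_mul_left]
  exact tsum_congr fun l => weight_addPart l.2

lemma tsum_addOverlined {k : ℕ} (hk : k % 2 = 1) :
    ∑' l : {l | l ∈ setU k ∧ k ∈ l.2}, weight q x y₁ y₂ z l =
      z * x * q ^ k * ∑' l : setW k, weight q x y₁ y₂ z l := by
  rw [← addOverlined_image_setW hk, tsum_image _ (addOverlined_injOn k), ← tsum_mul_left]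
  exact tsum_congr fun l => weight_addOverlined hk l.2

lemma isRecursiveSystem_weight (hq : ‖q‖ < 1) (hx : ‖x‖ ≤ 1) (hy₁ : ‖y₁‖ ≤ 1)
    (hy₂ : ‖y₂‖ ≤ 1) (hz : ‖z‖ ≤ 1) :
    IsRecursiveSystem q x y₁ y₂ z (fun k => ∑' l : setU k, weight q x y₁ y₂ z l)
      (fun k => ∑' l : setW k, weight q x y₁ y₂ z l) := by
  have hempty : MemA ∅ ∅ := by simp [MemA]
  refine ⟨fun k hk => ?_, fun k hk => ?_, fun k hk0 hk => ?_, fun k hk => ?_, fun k hk => ?_,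
    fun k _ hk => ?_, ?_, ?_⟩
  · rw [tsum_setU hq hx hy₁ hy₂ hz, tsum_addPart (by omega), tsum_addOverlined hk,
      if_neg (by omega), if_neg (by omega)]
    ring
  · rw [tsum_setU hq hx hy₁ hy₂ hz, tsum_addPart (by omega), overlined_eq_empty (by omega),
      if_pos hk, if_neg (by omega)]
    simp
  · rw [tsum_setU hq hx hy₁ hy₂ hz, tsum_addPart hk0, overlined_eq_empty (by omega),
      if_neg (by omega), if_pos hk]
    simp
  · conv_lhs => rw [setW_eq_union hk]
    rw [Summable.tsum_union_disjoint _ (summable_weight hq hx hy₁ hy₂ hz (setU_subset _))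
      (summable_weight hq hx hy₁ hy₂ hz fun l hl => hl.1.1), tsum_addPart (by omega),
      if_neg (by omega), if_neg (by omega)]
    · ring
    · exact Set.disjoint_right.2 fun l hl => notMem_setU_succ hl.2.1
  · rw [setW_of_mod_four_eq_two hk]
  · rw [setW_of_mod_four_eq_zero hk]
  · exact tendsto_tsum_weight hq hx hy₁ hy₂ hz (fun _ => subset_rfl)
      fun k => ⟨hempty, by simp⟩
  · refine tendsto_tsum_weight hq hx hy₁ hy₂ hz (fun k l hl => ⟨hl.1, fun p hp => ?_⟩)
      fun k => ⟨hempty, by simp⟩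
    have := (hl.2 p hp).1
    omega

end GeneratingFunction

/-- The quinvariate generating function for `𝒜` for `𝒜_{1,1̄}` (the parts `1` and `1̄` forbidden; third identity of Theorem 5.1). -/
theorem genfun_A_no1_no1bar (q x y₁ y₂ z : ℂ) (hq : ‖q‖ < 1)
    (hx : ‖x‖ ≤ 1) (hy₁ : ‖y₁‖ ≤ 1) (hy₂ : ‖y₂‖ ≤ 1) (hz : ‖z‖ ≤ 1) :
    Summable (fun lam : {p : Finset ℕ × Finset ℕ // MemA p.1 p.2 ∧ 1 ∉ p.1} =>
      x ^ lam.1.1.card * y₁ ^ countMod 2 4 lam.1.1 * y₂ ^ countMod 0 4 lam.1.1 *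
        z ^ lam.1.2.card * q ^ lam.1.1.sum id) ∧
    Summable (fun n : ℕ × ℕ × ℕ × ℕ =>
      x ^ (n.1 + n.2.1 + n.2.2.1 + n.2.2.2) * y₁ ^ n.2.2.1 * y₂ ^ n.2.2.2 * z ^ n.2.1 *
        q ^ (Qform n.1 n.2.1 n.2.2.1 n.2.2.2 + 3 * n.1 + 3 * n.2.1 + 2 * n.2.2.1 + 4 * n.2.2.2) /
        (qPoch (q ^ 2) (q ^ 2) n.1 * qPoch (q ^ 2) (q ^ 2) n.2.1 *
          qPoch (q ^ 4) (q ^ 4) n.2.2.1 * qPoch (q ^ 4) (q ^ 4) n.2.2.2)) ∧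
    ∑' lam : {p : Finset ℕ × Finset ℕ // MemA p.1 p.2 ∧ 1 ∉ p.1},
        x ^ lam.1.1.card * y₁ ^ countMod 2 4 lam.1.1 * y₂ ^ countMod 0 4 lam.1.1 *
          z ^ lam.1.2.card * q ^ lam.1.1.sum id =
      ∑' n : ℕ × ℕ × ℕ × ℕ,
        x ^ (n.1 + n.2.1 + n.2.2.1 + n.2.2.2) * y₁ ^ n.2.2.1 * y₂ ^ n.2.2.2 * z ^ n.2.1 *
          q ^ (Qform n.1 n.2.1 n.2.2.1 n.2.2.2 + 3 * n.1 + 3 * n.2.1 + 2 * n.2.2.1 + 4 * n.2.2.2) /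
          (qPoch (q ^ 2) (q ^ 2) n.1 * qPoch (q ^ 2) (q ^ 2) n.2.1 *
            qPoch (q ^ 4) (q ^ 4) n.2.2.1 * qPoch (q ^ 4) (q ^ 4) n.2.2.2) := by
  have hweight : ∀ l : Finset ℕ × Finset ℕ, x ^ l.1.card * y₁ ^ countMod 2 4 l.1 *
      y₂ ^ countMod 0 4 l.1 * z ^ l.2.card * q ^ l.1.sum id = weight q x y₁ y₂ z l :=
    fun l => by rw [weight]
  simp only [hweight]
  refine ⟨?_, summable_quadTerm hq hx hy₁ hy₂ hz (by norm_num) (by norm_num) (by norm_num)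
    (by norm_num), ?_⟩
  · exact summable_weight (s := {l | MemA l.1 l.2 ∧ 1 ∉ l.1}) hq hx hy₁ hy₂ hz fun l hl => hl.1
  · have h := (isRecursiveSystem_weight hq hx hy₁ hy₂ hz).unique hq hx hy₁ hy₂ hz
      (isRecursiveSystem_quad hq hx hy₁ hy₂ hz) two_pos
    rw [setU_two] at h
    exact h
end
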